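/- arXiv:1703.01332 — 2 statements merged into one kernel-verified Lean document; each statement's English description precedes it below -/
import Mathlib

section
/- Assume h : ℝ^p → [0,+∞] is convex, proper, the minimization problem defining β̂ has at least one solution, and h(β*) < +∞. Then ‖X(β̂ − β*)‖ ≤ inf{ r > 0 : H(r) ≤ r }, where H(t) = (1/t)·sup_{β∈ℝ^p : ‖X(β−β*)‖ ≤ t} (εᵀX(β−β*) + h(β*) − h(β)). -/
open scoped ENNReal

/-- Euclidean norm of a vector in `ℝ^k`. -/
noncomputable def l2norm {k : ℕ} (v : Fin k → ℝ) : ℝ := Real.sqrt (∑ i, (v i) ^ 2)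

/-- Euclidean inner product on `ℝ^k`. -/
noncomputable def dotp {k : ℕ} (u v : Fin k → ℝ) : ℝ := ∑ i, u i * v i

/-- `H(t) = (1/t) · sup_{β : ‖X(β-β*)‖ ≤ t} (εᵀX(β-β*) + h(β*) - h(β))`. -/
noncomputable def Hval {n p : ℕ} (X : Matrix (Fin n) (Fin p) ℝ) (bs : Fin p → ℝ)
    (h : (Fin p → ℝ) → ℝ≥0∞) (e : Fin n → ℝ) (t : ℝ) : ℝ :=
  sSup {x : ℝ | ∃ b : Fin p → ℝ, l2norm (X.mulVec (b - bs)) ≤ t ∧ h b ≠ ⊤ ∧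
      x = dotp e (X.mulVec (b - bs)) + (h bs).toReal - (h b).toReal} / t

theorem l2norm_sq {k : ℕ} (v : Fin k → ℝ) : l2norm v ^ 2 = ∑ i, v i ^ 2 :=
  Real.sq_sqrt (Finset.sum_nonneg fun _ _ => sq_nonneg _)

theorem l2norm_nonneg {k : ℕ} (v : Fin k → ℝ) : 0 ≤ l2norm v := Real.sqrt_nonneg _

theorem dotp_le_l2norm_mul_l2norm {k : ℕ} (u v : Fin k → ℝ) : dotp u v ≤ l2norm u * l2norm v :=
  Real.sum_mul_le_sqrt_mul_sqrt _ _ _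

theorem dotp_smul {k : ℕ} (u v : Fin k → ℝ) (a : ℝ) : dotp u (a • v) = a * dotp u v := by
  simp only [dotp, Finset.mul_sum, Pi.smul_apply, smul_eq_mul]
  exact Finset.sum_congr rfl fun i _ => by ring

theorem l2norm_smul {k : ℕ} (v : Fin k → ℝ) {a : ℝ} (ha : 0 ≤ a) :
    l2norm (a • v) = a * l2norm v := by
  rw [← sq_eq_sq₀ (l2norm_nonneg _) (mul_nonneg ha (l2norm_nonneg _)), mul_pow, l2norm_sq,
    l2norm_sq, Finset.mul_sum]
  exact Finset.sum_congr rfl fun i _ => by simp [mul_pow]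

theorem l2norm_sub_sq {k : ℕ} (u v : Fin k → ℝ) :
    l2norm (u - v) ^ 2 = l2norm u ^ 2 - 2 * dotp v u + l2norm v ^ 2 := by
  simp only [l2norm_sq, dotp, Finset.mul_sum, ← Finset.sum_sub_distrib, ← Finset.sum_add_distrib]
  exact Finset.sum_congr rfl fun i _ => by simp only [Pi.sub_apply]; ring

/-- The penalties are nonnegative, so the supremum defining `Hval` is that of a bounded set. -/
theorem le_Hval_mul {n p : ℕ} (X : Matrix (Fin n) (Fin p) ℝ) (bs : Fin p → ℝ)
    (h : (Fin p → ℝ) → ℝ≥0∞) (e : Fin n → ℝ) {t : ℝ} (ht : 0 < t) {b : Fin p → ℝ}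
    (hb : l2norm (X.mulVec (b - bs)) ≤ t) (hfin : h b ≠ ⊤) :
    dotp e (X.mulVec (b - bs)) + (h bs).toReal - (h b).toReal ≤ Hval X bs h e t * t := by
  rw [Hval, div_mul_cancel₀ _ ht.ne']
  refine le_csSup ⟨l2norm e * t + (h bs).toReal, ?_⟩ ⟨b, hb, hfin, rfl⟩
  rintro x ⟨c, hc, -, rfl⟩
  have h1 := dotp_le_l2norm_mul_l2norm e (X.mulVec (c - bs))
  have h2 := mul_le_mul_of_nonneg_left hc (l2norm_nonneg e)
  have h3 : 0 ≤ (h c).toReal := ENNReal.toReal_nonneg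
  linarith

/-- `‖X(β̂-β*)‖ ≤ inf { r > 0 : H(r) ≤ r }`, the infimum being `+∞` (in
`EReal`) when the set is empty. -/
theorem prediction_error_le_fixed_point_of_H {n p : ℕ} (X : Matrix (Fin n) (Fin p) ℝ)
    (bs : Fin p → ℝ) (ε : Fin n → ℝ) (y : Fin n → ℝ) (hy : y = X.mulVec bs + ε)
    (h : (Fin p → ℝ) → ℝ≥0∞)
    (hconv : ∀ b₁ b₂ : Fin p → ℝ, ∀ a : ℝ, 0 ≤ a → a ≤ 1 →
      h (a • b₁ + (1 - a) • b₂) ≤ ENNReal.ofReal a * h b₁ + ENNReal.ofReal (1 - a) * h b₂)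
    (hproper : ∃ b : Fin p → ℝ, h b ≠ ⊤)
    (hexists : ∀ (y' : Fin n → ℝ) (X' : Matrix (Fin n) (Fin p) ℝ),
      ∃ bhat' : Fin p → ℝ, ∀ b : Fin p → ℝ,
        ENNReal.ofReal (l2norm (X'.mulVec bhat' - y') ^ 2) + 2 * h bhat' ≤
          ENNReal.ofReal (l2norm (X'.mulVec b - y') ^ 2) + 2 * h b)
    (hfin : h bs ≠ ⊤)
    (bhat : Fin p → ℝ)
    (hmin : ∀ b : Fin p → ℝ,
      ENNReal.ofReal (l2norm (X.mulVec bhat - y) ^ 2) + 2 * h bhat ≤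
        ENNReal.ofReal (l2norm (X.mulVec b - y) ^ 2) + 2 * h b) :
    (l2norm (X.mulVec (bhat - bs)) : EReal) ≤
      sInf {x : EReal | ∃ r : ℝ, 0 < r ∧ Hval X bs h ε r ≤ r ∧ x = (r : EReal)} := by
  refine le_sInf ?_
  rintro _ ⟨r, hr, hH, rfl⟩
  rw [EReal.coe_le_coe_iff]
  by_contra! hlt
  set u := X.mulVec (bhat - bs) with hu
  set t := l2norm u with ht
  have ht0 : 0 < t := hr.trans hlt
  obtain ⟨a, ha⟩ : ∃ a, a = r / t := ⟨_, rfl⟩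
  have ha0 : 0 < a := ha ▸ div_pos hr ht0
  have ha1 : a < 1 := ha ▸ (div_lt_one ht0).2 hlt
  have hat : a * t = r := by rw [ha, div_mul_cancel₀ _ ht0.ne']
  have hhat : h bhat ≠ ⊤ := by
    intro htop
    have := hmin bs
    rw [htop, ENNReal.mul_top two_ne_zero, add_top, top_le_iff] at this
    exact ENNReal.add_ne_top.2 ⟨ENNReal.ofReal_ne_top, ENNReal.mul_ne_top (by simp) hfin⟩ this
  set b := a • bhat + (1 - a) • bs with hb
  have hXb : X.mulVec (b - bs) = a • u := by
    rw [hu, ← Matrix.mulVec_smul]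
    congr 1
    rw [hb]
    module
  have hres (c : Fin p → ℝ) : X.mulVec c - y = X.mulVec (c - bs) - ε := by
    rw [hy, Matrix.mulVec_sub]
    abel
  have hc := hconv bhat bs a ha0.le ha1.le
  rw [← hb] at hc
  have hrhs : ENNReal.ofReal a * h bhat + ENNReal.ofReal (1 - a) * h bs ≠ ⊤ :=
    ENNReal.add_ne_top.2 ⟨ENNReal.mul_ne_top ENNReal.ofReal_ne_top hhat,
      ENNReal.mul_ne_top ENNReal.ofReal_ne_top hfin⟩
  have hbfin : h b ≠ ⊤ := ne_top_of_le_ne_top hrhs hc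
  have hconvR : (h b).toReal ≤ a * (h bhat).toReal + (1 - a) * (h bs).toReal := by
    have := ENNReal.toReal_mono hrhs hc
    rwa [ENNReal.toReal_add (ENNReal.mul_ne_top ENNReal.ofReal_ne_top hhat)
      (ENNReal.mul_ne_top ENNReal.ofReal_ne_top hfin), ENNReal.toReal_mul, ENNReal.toReal_mul,
      ENNReal.toReal_ofReal ha0.le, ENNReal.toReal_ofReal (sub_nonneg.2 ha1.le)] at this
  have hminR : l2norm (u - ε) ^ 2 + 2 * (h bhat).toReal ≤
      l2norm (a • u - ε) ^ 2 + 2 * (h b).toReal := by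
    have h2 {c} (hc : h c ≠ ⊤) : 2 * h c ≠ ⊤ := ENNReal.mul_ne_top (by simp) hc
    have := ENNReal.toReal_mono (ENNReal.add_ne_top.2 ⟨ENNReal.ofReal_ne_top, h2 hbfin⟩) (hmin b)
    rwa [ENNReal.toReal_add ENNReal.ofReal_ne_top (h2 hhat),
      ENNReal.toReal_add ENNReal.ofReal_ne_top (h2 hbfin), ENNReal.toReal_ofReal (sq_nonneg _),
      ENNReal.toReal_ofReal (sq_nonneg _), ENNReal.toReal_mul, ENNReal.toReal_mul,
      ENNReal.toReal_ofNat, hres, hres, hXb] at this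
  rw [l2norm_sub_sq, l2norm_sub_sq, l2norm_smul _ ha0.le, dotp_smul, ← ht] at hminR
  have hsup := le_Hval_mul X bs h ε hr (b := b)
    (by rw [hXb, l2norm_smul _ ha0.le, ← ht, hat]) hbfin
  rw [hXb, dotp_smul] at hsup
  have hHr : Hval X bs h ε r * r ≤ r * r := mul_le_mul_of_nonneg_right hH hr.le
  set F := dotp ε u + (h bs).toReal - (h bhat).toReal with hF
  have hlow : (1 + a) * t ^ 2 ≤ 2 * F := by
    refine le_of_mul_le_mul_left ?_ (sub_pos.2 ha1)
    rw [hF]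
    linarith
  have hupp : F ≤ a * t ^ 2 := by
    refine le_of_mul_le_mul_left ?_ ha0
    have : a * (a * t ^ 2) = r * r := by rw [← hat]; ring
    rw [this, hF]
    linarith
  have : 0 < (1 - a) * t ^ 2 := mul_pos (sub_pos.2 ha1) (pow_pos ht0 2)
  linarith
end

section
/- Assume ε ~ N(0, σ²I_{n×n}) and that h : ℝ^p → [0,+∞] is convex, proper, and the minimization problem defining β̂ has at least one solution for any y and X. Then the map ε ↦ ‖X(β̂ − β*)‖ is a 1-Lipschitz function of ε, and consequently for every x > 0: P(‖X(β̂−β*)‖ ≥ m + σx) ≤ P(Z ≥ x) and P(‖X(β̂−β*)‖ ≤ m − σx) ≤ P(Z ≤ −x), where Z ~ N(0,1) and m is the median of the random variable ‖X(β̂−β*)‖. -/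
open MeasureTheory ProbabilityTheory
open scoped ENNReal NNReal

section GaussianConcentration

open Filter Topology Set

/-- The density of the standard normal distribution. -/
noncomputable def stdPDF (x : ℝ) : ℝ := gaussianPDFReal 0 1 x

/-- The distribution function of the standard normal distribution. -/
noncomputable def stdCDF (x : ℝ) : ℝ := (gaussianReal 0 1).real (Iic x)

lemma stdPDF_eq (x : ℝ) : stdPDF x = (√(2 * Real.pi))⁻¹ * Real.exp (-x ^ 2 / 2) := by
  simp [stdPDF, gaussianPDFReal]

lemma stdPDF_pos (x : ℝ) : 0 < stdPDF x := gaussianPDFReal_pos 0 1 x one_ne_zero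

lemma stdPDF_neg (x : ℝ) : stdPDF (-x) = stdPDF x := by simp [stdPDF_eq]

lemma hasDerivAt_stdPDF (x : ℝ) : HasDerivAt stdPDF (-(x * stdPDF x)) x := by
  have h : HasDerivAt (fun x : ℝ => (√(2 * Real.pi))⁻¹ * Real.exp (-x ^ 2 / 2))
      ((√(2 * Real.pi))⁻¹ * (Real.exp (-x ^ 2 / 2) * (-(2 * x) / 2))) x := by
    have := (((hasDerivAt_pow 2 x).neg.div_const 2).exp).const_mul (√(2 * Real.pi))⁻¹
    simpa using this
  rw [show stdPDF = _ from funext stdPDF_eq]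
  convert h using 1
  ring

lemma continuous_stdPDF : Continuous stdPDF :=
  continuous_iff_continuousAt.2 fun x => (hasDerivAt_stdPDF x).continuousAt

lemma stdPDF_le_of_abs_le {x y : ℝ} (h : |x| ≤ |y|) : stdPDF y ≤ stdPDF x := by
  rw [stdPDF_eq, stdPDF_eq]
  have := sq_le_sq.2 h
  gcongr

lemma stdPDF_le_one (x : ℝ) : stdPDF x ≤ 1 := by
  refine (stdPDF_le_of_abs_le (x := 0) (by simp)).trans ?_
  rw [stdPDF_eq]
  have : 1 ≤ √(2 * Real.pi) := Real.one_le_sqrt.2 (by linarith [Real.pi_gt_three])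
  simpa using inv_le_one_of_one_le₀ this

lemma abs_mul_stdPDF_le_one (x : ℝ) : |x * stdPDF x| ≤ 1 := by
  have h1 : 1 ≤ √(2 * Real.pi) := Real.one_le_sqrt.2 (by linarith [Real.pi_gt_three])
  have h2 : |x| ≤ Real.exp (x ^ 2 / 2) := by
    have := Real.add_one_le_exp (x ^ 2 / 2)
    nlinarith [sq_nonneg (|x| - 1), sq_abs x]
  rw [abs_mul, abs_of_pos (stdPDF_pos x), stdPDF_eq, neg_div, Real.exp_neg]
  have h3 := inv_le_one_of_one_le₀ h1
  have h4 : |x| * (Real.exp (x ^ 2 / 2))⁻¹ ≤ 1 := by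
    rw [← div_eq_mul_inv]; exact (div_le_one (Real.exp_pos _)).2 h2
  calc |x| * ((√(2 * Real.pi))⁻¹ * (Real.exp (x ^ 2 / 2))⁻¹)
      = (√(2 * Real.pi))⁻¹ * (|x| * (Real.exp (x ^ 2 / 2))⁻¹) := by ring
    _ ≤ 1 * 1 := by gcongr
    _ = 1 := one_mul 1

lemma hasDerivAt_stdCDF (x : ℝ) : HasDerivAt stdCDF (stdPDF x) x := by
  have hint : Integrable stdPDF := integrable_gaussianPDFReal 0 1
  have h : ∀ y, stdCDF y = stdCDF 0 + ∫ t in (0 : ℝ)..y, stdPDF t := by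
    have h' : ∀ y, stdCDF y = ∫ t in Iic y, stdPDF t := fun y => by
      rw [stdCDF, measureReal_def, gaussianReal_apply_eq_integral 0 one_ne_zero]
      exact ENNReal.toReal_ofReal (integral_nonneg fun t => (stdPDF_pos t).le)
    intro y
    rw [h', h', ← intervalIntegral.integral_Iic_sub_Iic hint.integrableOn hint.integrableOn]
    ring
  rw [show stdCDF = _ from funext h]
  exact (intervalIntegral.integral_hasDerivAt_right hint.intervalIntegrable
    (continuous_stdPDF.stronglyMeasurableAtFilter _ _) continuous_stdPDF.continuousAt).const_add _

lemma continuous_stdCDF : Continuous stdCDF :=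
  continuous_iff_continuousAt.2 fun x => (hasDerivAt_stdCDF x).continuousAt

lemma strictMono_stdCDF : StrictMono stdCDF :=
  strictMono_of_deriv_pos fun x => by rw [(hasDerivAt_stdCDF x).deriv]; exact stdPDF_pos x

lemma stdCDF_eq_cdf (x : ℝ) : stdCDF x = cdf (gaussianReal 0 1) x := (cdf_eq_real _ x).symm

lemma tendsto_stdCDF_atTop : Tendsto stdCDF atTop (𝓝 1) := by
  rw [show stdCDF = _ from funext stdCDF_eq_cdf]
  exact tendsto_cdf_atTop (gaussianReal 0 1)

lemma tendsto_stdCDF_atBot : Tendsto stdCDF atBot (𝓝 0) := by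
  rw [show stdCDF = _ from funext stdCDF_eq_cdf]
  exact tendsto_cdf_atBot (gaussianReal 0 1)

lemma stdCDF_mem_Ioo (x : ℝ) : stdCDF x ∈ Ioo (0 : ℝ) 1 := by
  refine ⟨lt_of_le_of_lt measureReal_nonneg (strictMono_stdCDF (sub_one_lt x)),
    lt_of_lt_of_le (strictMono_stdCDF (lt_add_one x)) measureReal_le_one⟩

lemma gaussianReal_Ici_eq (x : ℝ) : gaussianReal 0 1 (Ici x) = ENNReal.ofReal (1 - stdCDF x) := by
  have := nullSingletonClass_gaussianReal (μ := 0) (v := 1) one_ne_zero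
  rw [measure_congr Ioi_ae_eq_Ici.symm, ← compl_Iic, ← ofReal_measureReal,
    probReal_compl_eq_one_sub measurableSet_Iic, stdCDF]

lemma gaussianReal_Iic_neg (x : ℝ) : gaussianReal 0 1 (Iic (-x)) = gaussianReal 0 1 (Ici x) := by
  conv_lhs => rw [← neg_zero, ← gaussianReal_map_neg]
  rw [Measure.map_apply measurable_neg measurableSet_Iic]
  congr 1
  ext y
  simp

lemma stdCDF_neg (x : ℝ) : stdCDF (-x) = 1 - stdCDF x := by
  have h := gaussianReal_Iic_neg x
  rw [gaussianReal_Ici_eq, ← ofReal_measureReal,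
    ENNReal.ofReal_eq_ofReal_iff measureReal_nonneg
      (sub_nonneg.2 (stdCDF_mem_Ioo x).2.le)] at h
  exact h

lemma exists_stdCDF_eq {p : ℝ} (hp : p ∈ Ioo (0 : ℝ) 1) : ∃ x, stdCDF x = p :=
  mem_range_of_exists_le_of_exists_ge continuous_stdCDF
    ((tendsto_stdCDF_atBot.eventually (Iic_mem_nhds hp.1)).exists)
    ((tendsto_stdCDF_atTop.eventually (Ici_mem_nhds hp.2)).exists)

/-- The quantile function of the standard normal distribution. -/
noncomputable def stdQuantile : ℝ → ℝ := Function.invFun stdCDF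

lemma stdQuantile_stdCDF (x : ℝ) : stdQuantile (stdCDF x) = x :=
  Function.leftInverse_invFun strictMono_stdCDF.injective x

lemma stdCDF_stdQuantile {p : ℝ} (hp : p ∈ Ioo (0 : ℝ) 1) : stdCDF (stdQuantile p) = p :=
  Function.invFun_eq (exists_stdCDF_eq hp)

lemma strictMonoOn_stdQuantile : StrictMonoOn stdQuantile (Ioo 0 1) := fun p hp q hq hpq => by
  rwa [← strictMono_stdCDF.lt_iff_lt, stdCDF_stdQuantile hp, stdCDF_stdQuantile hq]

lemma stdQuantile_one_sub {p : ℝ} (hp : p ∈ Ioo (0 : ℝ) 1) :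
    stdQuantile (1 - p) = -stdQuantile p := by
  rw [← stdQuantile_stdCDF (-stdQuantile p), stdCDF_neg, stdCDF_stdQuantile hp]

/-- The Gaussian isoperimetric profile. -/
noncomputable def isoProfile (p : ℝ) : ℝ := stdPDF (stdQuantile p)

lemma isoProfile_pos (p : ℝ) : 0 < isoProfile p := stdPDF_pos _

lemma isoProfile_stdCDF (x : ℝ) : isoProfile (stdCDF x) = stdPDF x := by
  rw [isoProfile, stdQuantile_stdCDF]

lemma isoProfile_one_sub {p : ℝ} (hp : p ∈ Ioo (0 : ℝ) 1) :
    isoProfile (1 - p) = isoProfile p := by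
  rw [isoProfile, stdQuantile_one_sub hp, stdPDF_neg, isoProfile]

lemma hasDerivAt_stdQuantile {p : ℝ} (hp : p ∈ Ioo (0 : ℝ) 1) :
    HasDerivAt stdQuantile (isoProfile p)⁻¹ p := by
  have hnhds : Ioo (0 : ℝ) 1 ∈ 𝓝 p := isOpen_Ioo.mem_nhds hp
  refine HasDerivAt.of_local_left_inverse ?_ (hasDerivAt_stdCDF _) (stdPDF_pos _).ne'
    (eventually_of_mem hnhds fun q hq => stdCDF_stdQuantile hq)
  refine strictMonoOn_stdQuantile.continuousAt_of_image_mem_nhds hnhds ?_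
  have : stdQuantile '' Ioo 0 1 = univ :=
    eq_univ_of_forall fun x => ⟨stdCDF x, stdCDF_mem_Ioo x, stdQuantile_stdCDF x⟩
  rw [this]
  exact univ_mem

lemma hasDerivAt_isoProfile {p : ℝ} (hp : p ∈ Ioo (0 : ℝ) 1) :
    HasDerivAt isoProfile (-stdQuantile p) p := by
  have := (hasDerivAt_stdPDF (stdQuantile p)).comp p (hasDerivAt_stdQuantile hp)
  convert! this using 1
  have := (isoProfile_pos p).ne'
  rw [← isoProfile]
  field_simp

lemma continuousAt_isoProfile {p : ℝ} (hp : p ∈ Ioo (0 : ℝ) 1) : ContinuousAt isoProfile p :=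
  (hasDerivAt_isoProfile hp).continuousAt

lemma hasDerivAt_isoProfile_mul_stdQuantile {p : ℝ} (hp : p ∈ Ioo (0 : ℝ) 1) :
    HasDerivAt (fun p => isoProfile p * stdQuantile p) (1 - stdQuantile p ^ 2) p := by
  convert! (hasDerivAt_isoProfile hp).mul (hasDerivAt_stdQuantile hp) using 1
  have := (isoProfile_pos p).ne'
  field_simp
  ring

lemma hasDerivAt_isoProfile_sq {p : ℝ} (hp : p ∈ Ioo (0 : ℝ) 1) :
    HasDerivAt (fun p => isoProfile p ^ 2) (-2 * (isoProfile p * stdQuantile p)) p := by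
  convert! (hasDerivAt_isoProfile hp).pow 2 using 1
  push_cast
  ring

lemma monotone_div_stdPDF : Monotone fun t => t / stdPDF t := by
  refine monotone_of_hasDerivAt_nonneg
    (fun t => (hasDerivAt_id t).div (hasDerivAt_stdPDF t) (stdPDF_pos t).ne') fun t => ?_
  have := stdPDF_pos t
  have h : (1 : ℝ) * stdPDF t - id t * -(t * stdPDF t) = (1 + t ^ 2) * stdPDF t := by
    simp only [id]; ring
  simp only [h]
  positivity

lemma nonneg_of_hasDerivAt_nonneg {f f' : ℝ → ℝ} {x : ℝ} (hx : 0 ≤ x) (h0 : f 0 = 0)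
    (hf : ∀ y ∈ Icc 0 x, HasDerivAt f (f' y) y) (hf' : ∀ y ∈ Icc 0 x, 0 ≤ f' y) : 0 ≤ f x := by
  have hmono : MonotoneOn f (Icc 0 x) := by
    refine monotoneOn_of_hasDerivWithinAt_nonneg (convex_Icc 0 x)
      (fun y hy => (hf y hy).continuousAt.continuousWithinAt)
      (fun y hy => (hf y (interior_subset hy)).hasDerivWithinAt)
      (fun y hy => hf' y (interior_subset hy))
  rw [← h0]
  exact hmono ⟨le_rfl, hx⟩ ⟨hx, le_rfl⟩ hx

section TwoPoint

variable {c x : ℝ}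

lemma add_mem_Ioo_of_mem_Icc (h₁ : 0 < c - x) (h₂ : c + x < 1) {y : ℝ} (hy : y ∈ Icc 0 x) :
    c + y ∈ Ioo (0 : ℝ) 1 ∧ c - y ∈ Ioo (0 : ℝ) 1 := by
  obtain ⟨hy₀, hy₁⟩ := hy
  constructor <;> constructor <;> linarith

lemma hasDerivAt_comp_const_sub' {f : ℝ → ℝ} {f' a y : ℝ} (hf : HasDerivAt f f' (a - y)) :
    HasDerivAt (fun y => f (a - y)) (-f') y := by
  simpa using hf.comp_const_sub a y

lemma two_mul_sq_stdQuantile_le (hx : 0 ≤ x) (h₁ : 0 < c - x) (h₂ : c + x < 1) :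
    2 * stdQuantile c ^ 2 ≤ stdQuantile (c + x) ^ 2 + stdQuantile (c - x) ^ 2 := by
  have key : 0 ≤ stdQuantile (c + x) ^ 2 + stdQuantile (c - x) ^ 2 - 2 * stdQuantile c ^ 2 := by
    refine nonneg_of_hasDerivAt_nonneg
      (f := fun y => stdQuantile (c + y) ^ 2 + stdQuantile (c - y) ^ 2 - 2 * stdQuantile c ^ 2)
      (f' := fun y => 2 * (stdQuantile (c + y) / isoProfile (c + y)
        - stdQuantile (c - y) / isoProfile (c - y))) hx ?_ ?_ ?_
    · simp only [add_zero, sub_zero]; ring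
    · intro y hy
      obtain ⟨hp, hm⟩ := add_mem_Ioo_of_mem_Icc h₁ h₂ hy
      have hp' := (HasDerivAt.comp_const_add c y (hasDerivAt_stdQuantile hp)).pow 2
      have hm' := (hasDerivAt_comp_const_sub' (hasDerivAt_stdQuantile hm)).pow 2
      convert! (hp'.add hm').sub_const (2 * stdQuantile c ^ 2) using 1
      push_cast
      ring
    · intro y hy
      obtain ⟨hp, hm⟩ := add_mem_Ioo_of_mem_Icc h₁ h₂ hy
      have h : stdQuantile (c - y) ≤ stdQuantile (c + y) :=
        strictMonoOn_stdQuantile.monotoneOn hm hp (by linarith [hy.1])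
      have := monotone_div_stdPDF h
      simp only [isoProfile]
      linarith
  linarith

lemma two_mul_isoProfile_sq_le (hx : 0 ≤ x) (h₁ : 0 < c - x) (h₂ : c + x < 1) :
    2 * isoProfile c ^ 2 + 2 * stdQuantile c ^ 2 * x ^ 2 ≤
      isoProfile (c + x) ^ 2 + isoProfile (c - x) ^ 2 + 2 * x ^ 2 := by
  have hd : ∀ z ∈ Icc 0 x, 0 ≤ -2 * (isoProfile (c + z) * stdQuantile (c + z))
      + 2 * (isoProfile (c - z) * stdQuantile (c - z)) + 4 * (1 - stdQuantile c ^ 2) * z := by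
    intro z hz
    have hsub : Icc 0 z ⊆ Icc 0 x := Icc_subset_Icc_right hz.2
    refine nonneg_of_hasDerivAt_nonneg
      (f := fun z => -2 * (isoProfile (c + z) * stdQuantile (c + z))
        + 2 * (isoProfile (c - z) * stdQuantile (c - z)) + 4 * (1 - stdQuantile c ^ 2) * z)
      (f' := fun z => 2 * (stdQuantile (c + z) ^ 2 + stdQuantile (c - z) ^ 2
        - 2 * stdQuantile c ^ 2)) hz.1 ?_ ?_ ?_
    · simp only [add_zero, sub_zero]; ring
    · intro y hy
      obtain ⟨hp, hm⟩ := add_mem_Ioo_of_mem_Icc h₁ h₂ (hsub hy)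
      have hp' := (HasDerivAt.comp_const_add c y
        (hasDerivAt_isoProfile_mul_stdQuantile hp)).const_mul (-2)
      have hm' := (hasDerivAt_comp_const_sub'
        (hasDerivAt_isoProfile_mul_stdQuantile hm)).const_mul 2
      convert! (hp'.add hm').add ((hasDerivAt_id y).const_mul (4 * (1 - stdQuantile c ^ 2))) using 1
      ring
    · intro y hy
      have := two_mul_sq_stdQuantile_le (c := c) hy.1 (x := y) (by linarith [(hsub hy).2])
        (by linarith [(hsub hy).2])
      linarith
  have key : 0 ≤ isoProfile (c + x) ^ 2 + isoProfile (c - x) ^ 2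
      + 2 * (1 - stdQuantile c ^ 2) * x ^ 2 - 2 * isoProfile c ^ 2 := by
    refine nonneg_of_hasDerivAt_nonneg
      (f := fun x => isoProfile (c + x) ^ 2 + isoProfile (c - x) ^ 2
        + 2 * (1 - stdQuantile c ^ 2) * x ^ 2 - 2 * isoProfile c ^ 2) hx ?_ ?_ hd
    · simp only [add_zero, sub_zero]; ring
    · intro y hy
      obtain ⟨hp, hm⟩ := add_mem_Ioo_of_mem_Icc h₁ h₂ hy
      have hp' := HasDerivAt.comp_const_add c y (hasDerivAt_isoProfile_sq hp)
      have hm' := hasDerivAt_comp_const_sub' (hasDerivAt_isoProfile_sq hm)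
      convert! ((hp'.add hm').add ((hasDerivAt_pow 2 y).const_mul
        (2 * (1 - stdQuantile c ^ 2)))).sub_const (2 * isoProfile c ^ 2) using 1
      push_cast
      ring
  linarith

lemma abs_stdQuantile_add_le (hc : c ≤ 1 / 2) {y : ℝ} (hy : 0 ≤ y) (hp : c + y ∈ Ioo (0 : ℝ) 1)
    (hm : c - y ∈ Ioo (0 : ℝ) 1) : |stdQuantile (c + y)| ≤ |stdQuantile (c - y)| := by
  have h₁ : stdQuantile (c - y) ≤ stdQuantile (c + y) :=
    strictMonoOn_stdQuantile.monotoneOn hm hp (by linarith)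
  have h₂ : stdQuantile (c - y) ≤ -stdQuantile (c + y) := by
    rw [← stdQuantile_one_sub hp]
    exact strictMonoOn_stdQuantile.monotoneOn hm ⟨by linarith [hp.2], by linarith [hp.1]⟩
      (by linarith)
  rw [abs_of_nonpos (show stdQuantile (c - y) ≤ 0 by linarith)]
  exact abs_le.2 ⟨by linarith, by linarith⟩

lemma isoProfile_sq_sub_sq_le (hc : c ≤ 1 / 2) (hx : 0 ≤ x) (h₁ : 0 < c - x) (h₂ : c + x < 1) :
    isoProfile (c + x) ^ 2 - isoProfile (c - x) ^ 2 ≤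
      4 * isoProfile c * (-stdQuantile c) * x := by
  have hd : ∀ z ∈ Icc 0 x, 0 ≤ -4 * isoProfile c * stdQuantile c
      + 2 * (isoProfile (c + z) * stdQuantile (c + z))
      + 2 * (isoProfile (c - z) * stdQuantile (c - z)) := by
    intro z hz
    have hsub : Icc 0 z ⊆ Icc 0 x := Icc_subset_Icc_right hz.2
    refine nonneg_of_hasDerivAt_nonneg
      (f := fun z => -4 * isoProfile c * stdQuantile c
        + 2 * (isoProfile (c + z) * stdQuantile (c + z))
        + 2 * (isoProfile (c - z) * stdQuantile (c - z)))
      (f' := fun z => 2 * (stdQuantile (c - z) ^ 2 - stdQuantile (c + z) ^ 2)) hz.1 ?_ ?_ ?_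
    · simp only [add_zero, sub_zero]; ring
    · intro y hy
      obtain ⟨hp, hm⟩ := add_mem_Ioo_of_mem_Icc h₁ h₂ (hsub hy)
      have hp' := (HasDerivAt.comp_const_add c y
        (hasDerivAt_isoProfile_mul_stdQuantile hp)).const_mul 2
      have hm' := (hasDerivAt_comp_const_sub'
        (hasDerivAt_isoProfile_mul_stdQuantile hm)).const_mul 2
      convert! (hp'.const_add (-4 * isoProfile c * stdQuantile c)).add hm' using 1
      ring
    · intro y hy
      obtain ⟨hp, hm⟩ := add_mem_Ioo_of_mem_Icc h₁ h₂ (hsub hy)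
      have := sq_le_sq.2 (abs_stdQuantile_add_le hc hy.1 hp hm)
      linarith
  have key : 0 ≤ -4 * isoProfile c * stdQuantile c * x - isoProfile (c + x) ^ 2
      + isoProfile (c - x) ^ 2 := by
    refine nonneg_of_hasDerivAt_nonneg
      (f := fun x => -4 * isoProfile c * stdQuantile c * x - isoProfile (c + x) ^ 2
        + isoProfile (c - x) ^ 2) hx ?_ ?_ hd
    · simp only [add_zero, sub_zero]; ring
    · intro y hy
      obtain ⟨hp, hm⟩ := add_mem_Ioo_of_mem_Icc h₁ h₂ hy
      have hp' := HasDerivAt.comp_const_add c y (hasDerivAt_isoProfile_sq hp)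
      have hm' := hasDerivAt_comp_const_sub' (hasDerivAt_isoProfile_sq hm)
      convert! (((hasDerivAt_id y).const_mul (-4 * isoProfile c * stdQuantile c)).sub hp').add hm'
        using 1
      ring
  linarith

lemma le_sqrt_add_sqrt {a b k : ℝ} (ha : 0 ≤ a) (hb : 0 ≤ b)
    (h : (a - b) ^ 2 ≤ 8 * k ^ 2 * (a + b - 2 * k ^ 2)) : 2 * k ≤ √a + √b := by
  obtain ⟨ha', hb'⟩ := Real.sq_sqrt ha, Real.sq_sqrt hb
  have hA := Real.sqrt_nonneg a
  have hB := Real.sqrt_nonneg b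
  set A := √a
  set B := √b
  by_contra! hlt
  have h1 : (A + B) ^ 2 < 4 * k ^ 2 := by nlinarith
  have h2 : (A - B) ^ 2 ≤ (A + B) ^ 2 := by nlinarith [mul_nonneg hA hB]
  rw [← ha', ← hb'] at h
  nlinarith [mul_pos (sub_pos.2 h1) (sub_pos.2 (h2.trans_lt h1))]

lemma isoProfile_two_point_aux (hc : c ≤ 1 / 2) (hx : 0 ≤ x) (h₁ : 0 < c - x) (h₂ : c + x < 1) :
    2 * isoProfile c ≤
      √(isoProfile (c + x) ^ 2 + x ^ 2) + √(isoProfile (c - x) ^ 2 + x ^ 2) := by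
  obtain ⟨hp, hm⟩ := add_mem_Ioo_of_mem_Icc h₁ h₂ ⟨hx, le_rfl⟩
  refine le_sqrt_add_sqrt (by positivity) (by positivity) ?_
  have hv := two_mul_isoProfile_sq_le hx h₁ h₂
  have hu := isoProfile_sq_sub_sq_le hc hx h₁ h₂
  have hl : 0 ≤ isoProfile (c + x) ^ 2 - isoProfile (c - x) ^ 2 := by
    have := stdPDF_le_of_abs_le (abs_stdQuantile_add_le hc hx hp hm)
    have h0 := (isoProfile_pos (c - x)).le
    have := pow_le_pow_left₀ h0 this 2
    simp only [isoProfile] at this ⊢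
    linarith
  calc (isoProfile (c + x) ^ 2 + x ^ 2 - (isoProfile (c - x) ^ 2 + x ^ 2)) ^ 2
      = (isoProfile (c + x) ^ 2 - isoProfile (c - x) ^ 2) ^ 2 := by ring
    _ ≤ (4 * isoProfile c * (-stdQuantile c) * x) ^ 2 := pow_le_pow_left₀ hl hu 2
    _ = 8 * isoProfile c ^ 2 * (2 * stdQuantile c ^ 2 * x ^ 2) := by ring
    _ ≤ _ := by
      refine mul_le_mul_of_nonneg_left ?_ (by positivity)
      linarith

end TwoPoint

/-- Bobkov's two-point inequality. -/
lemma isoProfile_two_point {a b : ℝ} (ha : a ∈ Ioo (0 : ℝ) 1) (hb : b ∈ Ioo (0 : ℝ) 1) :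
    isoProfile ((a + b) / 2) ≤ (√(isoProfile a ^ 2 + ((a - b) / 2) ^ 2)
      + √(isoProfile b ^ 2 + ((b - a) / 2) ^ 2)) / 2 := by
  obtain ⟨ha₀, ha₁⟩ := ha
  obtain ⟨hb₀, hb₁⟩ := hb
  have main : ∀ {a b : ℝ}, 0 < a → a < 1 → 0 < b → b < 1 → b ≤ a → (a + b) / 2 ≤ 1 / 2 →
      isoProfile ((a + b) / 2) ≤ (√(isoProfile a ^ 2 + ((a - b) / 2) ^ 2)
        + √(isoProfile b ^ 2 + ((b - a) / 2) ^ 2)) / 2 := by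
    intro a b ha₀ ha₁ hb₀ hb₁ hab hc
    have := isoProfile_two_point_aux (c := (a + b) / 2) (x := (a - b) / 2) hc (by linarith)
      (by linarith) (by linarith)
    rw [show (a + b) / 2 + (a - b) / 2 = a by ring, show (a + b) / 2 - (a - b) / 2 = b by ring]
      at this
    rw [show ((b - a) / 2) ^ 2 = ((a - b) / 2) ^ 2 by ring]
    linarith
  have main' : ∀ {a b : ℝ}, 0 < a → a < 1 → 0 < b → b < 1 → (a + b) / 2 ≤ 1 / 2 →
      isoProfile ((a + b) / 2) ≤ (√(isoProfile a ^ 2 + ((a - b) / 2) ^ 2)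
        + √(isoProfile b ^ 2 + ((b - a) / 2) ^ 2)) / 2 := by
    intro a b ha₀ ha₁ hb₀ hb₁ hc
    rcases le_total b a with hab | hab
    · exact main ha₀ ha₁ hb₀ hb₁ hab hc
    · rw [add_comm a, add_comm (√_)]
      exact main hb₀ hb₁ ha₀ ha₁ hab (by linarith)
  rcases le_total ((a + b) / 2) (1 / 2) with hc | hc
  · exact main' ha₀ ha₁ hb₀ hb₁ hc
  · have := main' (a := 1 - a) (b := 1 - b) (by linarith) (by linarith) (by linarith)
      (by linarith) (by linarith)
    rw [show (1 - a + (1 - b)) / 2 = 1 - (a + b) / 2 by ring,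
      isoProfile_one_sub ⟨by linarith, by linarith⟩, isoProfile_one_sub ⟨ha₀, ha₁⟩,
      isoProfile_one_sub ⟨hb₀, hb₁⟩, show (1 - a - (1 - b)) / 2 = (b - a) / 2 by ring,
      show (1 - b - (1 - a)) / 2 = (a - b) / 2 by ring] at this
    rwa [show ((a - b) / 2) ^ 2 = ((b - a) / 2) ^ 2 by ring] at this ⊢

/-- The average of a function over the discrete cube. -/
noncomputable def cubeAvg {N : ℕ} (F : (Fin N → Bool) → ℝ) : ℝ := (∑ x, F x) / 2 ^ N

lemma cubeAvg_zero (F : (Fin 0 → Bool) → ℝ) : cubeAvg F = F default := by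
  simp only [cubeAvg, pow_zero, div_one, Fintype.sum_unique]
  exact congrArg F (Subsingleton.elim _ _)

lemma cubeAvg_succ {N : ℕ} (F : (Fin (N + 1) → Bool) → ℝ) :
    cubeAvg F = (cubeAvg (fun x => F (Fin.cons true x))
      + cubeAvg (fun x => F (Fin.cons false x))) / 2 := by
  have h : ∑ x, F x = ∑ x : Fin N → Bool, F (Fin.cons true x) +
      ∑ x : Fin N → Bool, F (Fin.cons false x) := by
    rw [← (Fin.consEquiv fun _ : Fin (N + 1) => Bool).sum_comp, Fintype.sum_prod_type]
    simp [Fin.consEquiv]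
  rw [cubeAvg, cubeAvg, cubeAvg, h, pow_succ]
  field_simp

lemma cubeAvg_mono {N : ℕ} {F G : (Fin N → Bool) → ℝ} (h : ∀ x, F x ≤ G x) :
    cubeAvg F ≤ cubeAvg G := by
  unfold cubeAvg
  gcongr with x
  exact h x

lemma cubeAvg_sub {N : ℕ} (F G : (Fin N → Bool) → ℝ) :
    cubeAvg (fun x => F x - G x) = cubeAvg F - cubeAvg G := by
  simp [cubeAvg, Finset.sum_sub_distrib, sub_div]

lemma cubeAvg_mem_Ioo {N : ℕ} {F : (Fin N → Bool) → ℝ} (h : ∀ x, F x ∈ Ioo (0 : ℝ) 1) :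
    cubeAvg F ∈ Ioo (0 : ℝ) 1 := by
  have hcard : ∑ _x : Fin N → Bool, (1 : ℝ) = 2 ^ N := by simp
  refine ⟨div_pos (Finset.sum_pos (fun x _ => (h x).1) Finset.univ_nonempty) (by positivity), ?_⟩
  rw [cubeAvg, div_lt_one (by positivity), ← hcard]
  exact Finset.sum_lt_sum_of_nonempty Finset.univ_nonempty fun x _ => (h x).2

lemma sqrt_sq_add_sq_sum_le {ι : Type*} (s : Finset ι) (f g : ι → ℝ) :
    √((∑ i ∈ s, f i) ^ 2 + (∑ i ∈ s, g i) ^ 2) ≤ ∑ i ∈ s, √(f i ^ 2 + g i ^ 2) := by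
  have h : ∀ a b : ℝ, √(a ^ 2 + b ^ 2) = ‖(⟨a, b⟩ : ℂ)‖ := fun a b => by
    rw [Complex.norm_def, Complex.normSq_mk, sq, sq]
  simp only [h]
  refine le_of_eq_of_le ?_ (norm_sum_le _ _)
  congr 1
  apply Complex.ext <;> simp

lemma sqrt_sq_cubeAvg_le {N : ℕ} (F G : (Fin N → Bool) → ℝ) :
    √(cubeAvg F ^ 2 + cubeAvg G ^ 2) ≤ cubeAvg fun x => √(F x ^ 2 + G x ^ 2) := by
  have h : (0 : ℝ) < 2 ^ N := by positivity
  unfold cubeAvg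
  rw [div_pow, div_pow, ← add_div, Real.sqrt_div (by positivity), Real.sqrt_sq h.le]
  gcongr
  exact sqrt_sq_add_sq_sum_le _ _ _

/-- The sum of the squared discrete partial derivatives on the discrete cube. -/
noncomputable def cubeGradSq {N : ℕ} (F : (Fin N → Bool) → ℝ) (x : Fin N → Bool) : ℝ :=
  ∑ i, ((F x - F (Function.update x i (!x i))) / 2) ^ 2

lemma cubeGradSq_nonneg {N : ℕ} (F : (Fin N → Bool) → ℝ) (x : Fin N → Bool) :
    0 ≤ cubeGradSq F x := Finset.sum_nonneg fun _ _ => sq_nonneg _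

lemma cubeGradSq_cons {N : ℕ} (F : (Fin (N + 1) → Bool) → ℝ) (b : Bool) (x : Fin N → Bool) :
    cubeGradSq F (Fin.cons b x) = ((F (Fin.cons b x) - F (Fin.cons (!b) x)) / 2) ^ 2
      + cubeGradSq (fun x => F (Fin.cons b x)) x := by
  simp [cubeGradSq, Fin.sum_univ_succ, Fin.cons_update]

/-- Bobkov's inequality on the discrete cube. -/
lemma isoProfile_cubeAvg_le {N : ℕ} (F : (Fin N → Bool) → ℝ) (hF : ∀ x, F x ∈ Ioo (0 : ℝ) 1) :
    isoProfile (cubeAvg F) ≤ cubeAvg fun x => √(isoProfile (F x) ^ 2 + cubeGradSq F x) := by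
  induction N with
  | zero =>
    rw [cubeAvg_zero, cubeAvg_zero]
    refine Real.le_sqrt_of_sq_le ?_
    linarith [cubeGradSq_nonneg F default]
  | succ N ih =>
    have half : ∀ b : Bool, √(isoProfile (cubeAvg fun x => F (Fin.cons b x)) ^ 2 +
        ((cubeAvg (fun x => F (Fin.cons b x)) - cubeAvg fun x => F (Fin.cons (!b) x)) / 2) ^ 2) ≤
        cubeAvg fun x => √(isoProfile (F (Fin.cons b x)) ^ 2 + cubeGradSq F (Fin.cons b x)) := by
      intro b
      have h := ih (fun x => F (Fin.cons b x)) fun x => hF _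
      have hd : (cubeAvg (fun x => F (Fin.cons b x)) - cubeAvg fun x => F (Fin.cons (!b) x)) / 2 =
          cubeAvg fun x => (F (Fin.cons b x) - F (Fin.cons (!b) x)) / 2 := by
        rw [← cubeAvg_sub, cubeAvg, cubeAvg, ← Finset.sum_div]
        ring
      rw [hd]
      refine (Real.sqrt_le_sqrt (add_le_add_left (pow_le_pow_left₀ (isoProfile_pos _).le h 2)
        _)).trans ((sqrt_sq_cubeAvg_le _ _).trans (le_of_eq ?_))
      congr 1 with x
      rw [Real.sq_sqrt (add_nonneg (sq_nonneg _) (cubeGradSq_nonneg _ _)), cubeGradSq_cons]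
      ring_nf
    have h2 := isoProfile_two_point (cubeAvg_mem_Ioo fun x => hF (Fin.cons true x))
      (cubeAvg_mem_Ioo fun x => hF (Fin.cons false x))
    rw [cubeAvg_succ, cubeAvg_succ]
    exact h2.trans (div_le_div_of_nonneg_right (add_le_add (half true) (half false)) two_pos.le)

/-- The sign in `{-1, 1}` attached to a Boolean. -/
def boolSign (b : Bool) : ℝ := if b then 1 else -1

/-- The normalized sums, with `k` signs in each of the `n` coordinates. -/
noncomputable def cubeSum (n k : ℕ) (x : Fin (n * k) → Bool) : EuclideanSpace ℝ (Fin n) :=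
  WithLp.toLp 2 fun j => (√k)⁻¹ * ∑ i : Fin k, boolSign (x (finProdFinEquiv (j, i)))

/-- The law of the normalized sums of independent signs. -/
noncomputable def cubeLaw (n k : ℕ) : ProbabilityMeasure (EuclideanSpace ℝ (Fin n)) :=
  ⟨(PMF.uniformOfFintype (Fin (n * k) → Bool)).toMeasure.map (cubeSum n k),
    Measure.isProbabilityMeasure_map (Measurable.of_discrete).aemeasurable⟩

lemma integral_cubeLaw {V : Type*} [NormedAddCommGroup V] [NormedSpace ℝ V] [CompleteSpace V]
    (n k : ℕ) {F : EuclideanSpace ℝ (Fin n) → V} (hF : Continuous F) :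
    ∫ z, F z ∂(cubeLaw n k : Measure (EuclideanSpace ℝ (Fin n))) =
      ((2 : ℝ) ^ (n * k))⁻¹ • ∑ x, F (cubeSum n k x) := by
  have : (cubeLaw n k : Measure (EuclideanSpace ℝ (Fin n))) =
    (PMF.uniformOfFintype (Fin (n * k) → Bool)).toMeasure.map (cubeSum n k) := rfl
  rw [this, integral_map (Measurable.of_discrete).aemeasurable hF.aestronglyMeasurable,
    PMF.integral_eq_sum, Finset.smul_sum]
  simp [PMF.uniformOfFintype_apply]

lemma integral_cubeLaw_real (n k : ℕ) {F : EuclideanSpace ℝ (Fin n) → ℝ} (hF : Continuous F) :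
    ∫ z, F z ∂(cubeLaw n k : Measure (EuclideanSpace ℝ (Fin n))) =
      cubeAvg fun x => F (cubeSum n k x) := by
  rw [integral_cubeLaw n k hF, cubeAvg, smul_eq_mul, div_eq_inv_mul]

lemma charFun_cubeLaw (n k : ℕ) (t : EuclideanSpace ℝ (Fin n)) :
    charFun (cubeLaw n k : Measure (EuclideanSpace ℝ (Fin n))) t =
      ∏ j, (Complex.cos (((√k)⁻¹ * t j : ℝ) : ℂ)) ^ k := by
  rw [charFun_apply, integral_cubeLaw n k (by fun_prop)]
  have h : ∀ x : Fin (n * k) → Bool,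
      Complex.exp ((inner ℝ (cubeSum n k x) t : ℝ) * Complex.I) =
        ∏ m, Complex.exp ((boolSign (x m) * ((√k)⁻¹ * t (finProdFinEquiv.symm m).1) : ℝ)
          * Complex.I) := by
    intro x
    rw [← Complex.exp_sum, ← Finset.sum_mul, ← Complex.ofReal_sum]
    congr 3
    rw [← finProdFinEquiv.sum_comp, Fintype.sum_prod_type, PiLp.inner_apply]
    refine Finset.sum_congr rfl fun j _ => ?_
    simp only [cubeSum, Equiv.symm_apply_apply, ← Finset.sum_mul, RCLike.inner_apply, conj_trivial]
    ring
  simp_rw [h]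
  have h2 : ∑ x : Fin (n * k) → Bool, ∏ m, Complex.exp ((boolSign (x m) *
      ((√k)⁻¹ * t (finProdFinEquiv.symm m).1) : ℝ) * Complex.I) =
      ∏ m : Fin (n * k), ∑ b : Bool, Complex.exp ((boolSign b *
      ((√k)⁻¹ * t (finProdFinEquiv.symm m).1) : ℝ) * Complex.I) := by
    rw [Finset.prod_univ_sum, Fintype.piFinset_univ]
  have h3 : ∀ a : ℝ, ∑ b : Bool, Complex.exp ((boolSign b * a : ℝ) * Complex.I) =
      2 * Complex.cos a := by
    intro a
    rw [Complex.two_cos]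
    simp [boolSign]
  rw [h2]
  simp_rw [h3]
  rw [Finset.prod_mul_distrib, ← finProdFinEquiv.prod_comp (fun m => Complex.cos _),
    Fintype.prod_prod_type]
  simp

lemma tendsto_cos_pow (t : ℝ) :
    Tendsto (fun k : ℕ => (Complex.cos (((√k)⁻¹ * t : ℝ) : ℂ)) ^ k) atTop
      (𝓝 (Complex.exp (-t ^ 2 / 2))) := by
  have hX : Measurable boolSign := Measurable.of_discrete
  have h := tendsto_charFun_inv_sqrt_mul_pow (P := (PMF.uniformOfFintype Bool).toMeasure)
    hX.aemeasurable (by simp [PMF.integral_eq_sum, boolSign])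
    (by rw [PMF.integral_eq_sum]; norm_num [boolSign]) t
  refine h.congr fun k => ?_
  congr 1
  rw [charFun_apply, integral_map hX.aemeasurable (by fun_prop), PMF.integral_eq_sum,
    Complex.cos]
  simp [boolSign]
  ring

lemma tendsto_cubeLaw (n : ℕ) :
    Tendsto (cubeLaw n) atTop (𝓝 ⟨stdGaussian (EuclideanSpace ℝ (Fin n)), inferInstance⟩) := by
  refine ProbabilityMeasure.tendsto_of_tendsto_charFun fun t => ?_
  simp only [charFun_cubeLaw, ProbabilityMeasure.coe_mk, charFun_stdGaussian]
  have : Complex.exp (-(‖t‖ : ℂ) ^ 2 / 2) = ∏ j, Complex.exp (-(t j : ℂ) ^ 2 / 2) := by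
    rw [← Complex.exp_sum, ← Finset.sum_div, ← Complex.ofReal_pow, EuclideanSpace.real_norm_sq_eq]
    simp
  rw [this]
  exact tendsto_finsetProd _ fun j _ => tendsto_cos_pow (t j)

lemma abs_sub_sub_fderiv_le {V : Type*} [NormedAddCommGroup V] [NormedSpace ℝ V] {w : V → ℝ}
    {w' : V → V →L[ℝ] ℝ} {C : ℝ} (hw : ∀ x, HasFDerivAt w (w' x) x)
    (hC : ∀ x y, ‖w' x - w' y‖ ≤ C * ‖x - y‖) (x v : V) :
    |w (x + v) - w x - w' x v| ≤ C * ‖v‖ ^ 2 := by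
  have hC0 : 0 ≤ C * ‖v‖ := by simpa using (norm_nonneg _).trans (hC (x + v) x)
  have := (convex_segment x (x + v)).norm_image_sub_le_of_norm_hasFDerivWithin_le'
    (f := w) (f' := w') (φ := w' x) (C := C * ‖v‖) (fun y _ => (hw y).hasFDerivWithinAt)
    (fun y hy => ?_) (left_mem_segment ℝ x (x + v)) (right_mem_segment ℝ x (x + v))
  · simpa [sq, mul_assoc] using this
  · obtain ⟨θ, ⟨h0, h1⟩, rfl⟩ := (segment_eq_image' ℝ x (x + v)).subset hy
    refine (hC _ x).trans ?_
    have : ‖x + θ • (x + v - x) - x‖ = θ * ‖v‖ := by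
      simp [norm_smul, abs_of_nonneg h0]
    rw [this]
    nlinarith

lemma abs_stdCDF_add_sub_le (s h : ℝ) :
    |stdCDF (s + h) - stdCDF s| ≤ stdPDF s * |h| + h ^ 2 := by
  have hlip : ∀ x y, |stdPDF x - stdPDF y| ≤ |x - y| := fun x y => by
    have := Convex.norm_image_sub_le_of_norm_hasDerivWithin_le (C := 1) (s := univ)
      (fun z _ => (hasDerivAt_stdPDF z).hasDerivWithinAt)
      (fun z _ => by simpa [abs_mul] using abs_mul_stdPDF_le_one z) convex_univ (mem_univ y)
      (mem_univ x)
    simpa using this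
  have h1 := abs_sub_sub_fderiv_le (w := stdCDF) (C := 1)
    (fun x => (hasDerivAt_stdCDF x).hasFDerivAt) (fun x y => by
      rw [one_mul, ← sub_eq_zero.1 (by ext; simp :
        ContinuousLinearMap.toSpanSingleton ℝ (stdPDF x - stdPDF y) -
        (ContinuousLinearMap.toSpanSingleton ℝ (stdPDF x) -
          ContinuousLinearMap.toSpanSingleton ℝ (stdPDF y)) = 0)]
      simpa using hlip x y) s h
  have h2 : |stdCDF (s + h) - stdCDF s - stdPDF s * h| ≤ h ^ 2 := by
    simpa [mul_comm] using h1
  calc |stdCDF (s + h) - stdCDF s|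
      = |stdPDF s * h + (stdCDF (s + h) - stdCDF s - stdPDF s * h)| := by ring_nf
    _ ≤ |stdPDF s * h| + |stdCDF (s + h) - stdCDF s - stdPDF s * h| := abs_add_le _ _
    _ ≤ stdPDF s * |h| + h ^ 2 := by
      rw [abs_mul, abs_of_pos (stdPDF_pos s)]
      gcongr

lemma cubeSum_update {n k : ℕ} (x : Fin (n * k) → Bool) (j : Fin n) (i : Fin k) :
    cubeSum n k (Function.update x (finProdFinEquiv (j, i)) (!x (finProdFinEquiv (j, i)))) =
      cubeSum n k x + EuclideanSpace.single j
        ((√k)⁻¹ * (-2 * boolSign (x (finProdFinEquiv (j, i))))) := by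
  ext j'
  simp only [cubeSum, PiLp.add_apply, PiLp.single_apply]
  have hflip : ∀ b, boolSign (!b) = boolSign b + -2 * boolSign b := by
    intro b; cases b <;> norm_num [boolSign]
  have hterm : ∀ i', boolSign (Function.update x (finProdFinEquiv (j, i))
      (!x (finProdFinEquiv (j, i))) (finProdFinEquiv (j', i'))) =
      boolSign (x (finProdFinEquiv (j', i'))) +
      if j' = j then (if i' = i then -2 * boolSign (x (finProdFinEquiv (j, i))) else 0) else 0 := by
    intro i'
    by_cases hj : j' = j
    · by_cases hi : i' = i
      · subst hj hi
        simp [hflip]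
      · rw [Function.update_of_ne (by simp [hi])]
        simp [hi]
    · rw [Function.update_of_ne (by simp [hj])]
      simp [hj]
  simp_rw [hterm]
  rw [Finset.sum_add_distrib, mul_add]
  split_ifs <;> simp

lemma sum_sq_apply_single {n : ℕ} (ℓ : EuclideanSpace ℝ (Fin n) →L[ℝ] ℝ) :
    ∑ j, ℓ (EuclideanSpace.single j 1) ^ 2 = ‖ℓ‖ ^ 2 := by
  set g := (InnerProductSpace.toDual ℝ (EuclideanSpace ℝ (Fin n))).symm ℓ
  have hg : ∀ v, ℓ v = inner ℝ g v := fun v => by simp [g]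
  have hn : ‖ℓ‖ = ‖g‖ := by simp [g]
  rw [hn, EuclideanSpace.real_norm_sq_eq]
  refine Finset.sum_congr rfl fun j _ => ?_
  rw [hg, EuclideanSpace.inner_single_right]
  simp

lemma norm_apply_single_le {n : ℕ} (ℓ : EuclideanSpace ℝ (Fin n) →L[ℝ] ℝ) (j : Fin n) :
    |ℓ (EuclideanSpace.single j 1)| ≤ ‖ℓ‖ := by
  simpa using ℓ.le_opNorm (EuclideanSpace.single j 1)

lemma sqrt_add_le_sqrt_add_sqrt {a b : ℝ} (ha : 0 ≤ a) (hb : 0 ≤ b) : √(a + b) ≤ √a + √b := by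
  refine Real.sqrt_le_iff.2 ⟨by positivity, ?_⟩
  have : 0 ≤ √a * √b := by positivity
  nlinarith [Real.sq_sqrt ha, Real.sq_sqrt hb]

section Smooth

variable {n : ℕ} {w : EuclideanSpace ℝ (Fin n) → ℝ}
  {w' : EuclideanSpace ℝ (Fin n) → EuclideanSpace ℝ (Fin n) →L[ℝ] ℝ} {L C : ℝ}

lemma abs_stdCDF_comp_add_sub_le (hw : ∀ x, HasFDerivAt w (w' x) x) (hL : ∀ x, ‖w' x‖ ≤ L)
    (hC : ∀ x y, ‖w' x - w' y‖ ≤ C * ‖x - y‖) (x v : EuclideanSpace ℝ (Fin n)) :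
    |stdCDF (w (x + v)) - stdCDF (w x)| ≤
      stdPDF (w x) * |w' x v| + (C + L ^ 2) * ‖v‖ ^ 2 := by
  set h := w (x + v) - w x with hh
  have hL0 : 0 ≤ L := (norm_nonneg _).trans (hL x)
  have h1 : |h| ≤ L * ‖v‖ := by
    have := Convex.norm_image_sub_le_of_norm_hasFDerivWithin_le (s := univ) (C := L)
      (fun z _ => (hw z).hasFDerivWithinAt) (fun z _ => hL z) convex_univ (mem_univ x)
      (mem_univ (x + v))
    simpa using this
  have h2 := abs_sub_sub_fderiv_le hw hC x v
  have h3 : |h| ≤ |w' x v| + C * ‖v‖ ^ 2 := by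
    have := abs_sub_abs_le_abs_sub h (w' x v)
    linarith
  have h4 := abs_stdCDF_add_sub_le (w x) h
  rw [hh, add_sub_cancel, ← hh] at h4
  have h5 : h ^ 2 ≤ L ^ 2 * ‖v‖ ^ 2 := by
    rw [← mul_pow, ← sq_abs]
    exact pow_le_pow_left₀ (abs_nonneg _) h1 2
  have h6 : 0 ≤ C * ‖v‖ ^ 2 := (abs_nonneg _).trans h2
  have h7 := mul_le_mul_of_nonneg_left h3 (stdPDF_pos (w x)).le
  have h8 := mul_le_mul_of_nonneg_right (stdPDF_le_one (w x)) h6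
  linarith

lemma cubeGradSq_stdCDF_comp_le (hw : ∀ x, HasFDerivAt w (w' x) x) (hL : ∀ x, ‖w' x‖ ≤ L)
    (hC0 : 0 ≤ C) (hC : ∀ x y, ‖w' x - w' y‖ ≤ C * ‖x - y‖) {k : ℕ} (hk : 0 < k)
    (x : Fin (n * k) → Bool) :
    cubeGradSq (fun x => stdCDF (w (cubeSum n k x))) x ≤
      stdPDF (w (cubeSum n k x)) ^ 2 * L ^ 2 +
        n * (4 * (C + L ^ 2) * L + 4 * (C + L ^ 2) ^ 2) * (√k)⁻¹ := by
  set z := cubeSum n k x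
  set K := C + L ^ 2
  set r := (√(k : ℝ))⁻¹
  have hL0 : 0 ≤ L := (norm_nonneg _).trans (hL z)
  have hK0 : 0 ≤ K := by positivity
  have hr0 : 0 ≤ r := by positivity
  have hr1 : r ≤ 1 := inv_le_one_of_one_le₀ (Real.one_le_sqrt.2 (by exact_mod_cast hk))
  have hkr : k * r ^ 2 = 1 := by
    rw [inv_pow, Real.sq_sqrt (by positivity)]
    exact mul_inv_cancel₀ (by positivity)
  have hterm : ∀ (j : Fin n) (i : Fin k), ((stdCDF (w z) - stdCDF (w (cubeSum n k
      (Function.update x (finProdFinEquiv (j, i)) (!x (finProdFinEquiv (j, i))))))) / 2) ^ 2 ≤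
      r ^ 2 * (stdPDF (w z) ^ 2 * w' z (EuclideanSpace.single j 1) ^ 2
        + (4 * K * L + 4 * K ^ 2) * r) := by
    intro j i
    set b := boolSign (x (finProdFinEquiv (j, i))) with hb
    have hb1 : |b| = 1 := by
      rw [hb, boolSign]; split_ifs <;> simp
    set d := w' z (EuclideanSpace.single j 1)
    set v : EuclideanSpace ℝ (Fin n) := EuclideanSpace.single j (r * (-2 * b)) with hv
    have hvnorm : ‖v‖ = 2 * r := by
      rw [hv, PiLp.norm_single, Real.norm_eq_abs, abs_mul, abs_mul, hb1, abs_of_nonneg hr0]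
      norm_num
      ring
    have hvd : |w' z v| = 2 * r * |d| := by
      have : v = (r * (-2 * b)) • EuclideanSpace.single j (1 : ℝ) := by
        ext i
        rw [hv, PiLp.smul_apply, PiLp.single_apply, PiLp.single_apply, smul_eq_mul, mul_ite,
          mul_one, mul_zero]
      rw [this, map_smul, smul_eq_mul, abs_mul, abs_mul, abs_mul, hb1, abs_of_nonneg hr0]
      norm_num
      ring
    have h1 := abs_stdCDF_comp_add_sub_le hw hL hC z v
    rw [hvnorm, hvd] at h1
    rw [cubeSum_update]
    have h2 : |(stdCDF (w z) - stdCDF (w (z + v))) / 2| ≤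
        r * (stdPDF (w z) * |d| + 2 * K * r) := by
      rw [abs_div, abs_sub_comm, abs_two]
      linarith
    have hd : |d| ≤ L := (norm_apply_single_le _ j).trans (hL z)
    have hp0 := (stdPDF_pos (w z)).le
    have hpd : stdPDF (w z) * |d| ≤ L := by
      simpa using mul_le_mul (stdPDF_le_one (w z)) hd (abs_nonneg _) zero_le_one
    calc ((stdCDF (w z) - stdCDF (w (z + v))) / 2) ^ 2
        = |(stdCDF (w z) - stdCDF (w (z + v))) / 2| ^ 2 := (sq_abs _).symm
      _ ≤ (r * (stdPDF (w z) * |d| + 2 * K * r)) ^ 2 := pow_le_pow_left₀ (abs_nonneg _) h2 2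
      _ = r ^ 2 * (stdPDF (w z) ^ 2 * |d| ^ 2
            + 4 * (K * r) * (stdPDF (w z) * |d|) + 4 * K ^ 2 * r * r) := by ring
      _ ≤ r ^ 2 * (stdPDF (w z) ^ 2 * |d| ^ 2 + 4 * (K * r) * L + 4 * K ^ 2 * r * 1) := by
        gcongr
      _ = _ := by rw [sq_abs]; ring
  calc cubeGradSq (fun x => stdCDF (w (cubeSum n k x))) x
      = ∑ j : Fin n, ∑ i : Fin k, ((stdCDF (w z) - stdCDF (w (cubeSum n k (Function.update x
          (finProdFinEquiv (j, i)) (!x (finProdFinEquiv (j, i))))))) / 2) ^ 2 := by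
        rw [cubeGradSq, ← finProdFinEquiv.sum_comp, Fintype.sum_prod_type]
    _ ≤ ∑ j : Fin n, ∑ i : Fin k, r ^ 2 * (stdPDF (w z) ^ 2 *
          w' z (EuclideanSpace.single j 1) ^ 2 + (4 * K * L + 4 * K ^ 2) * r) := by
        gcongr with j _ i _
        exact hterm j i
    _ = k * r ^ 2 * (stdPDF (w z) ^ 2 * ∑ j, w' z (EuclideanSpace.single j 1) ^ 2
          + n * (4 * K * L + 4 * K ^ 2) * r) := by
        simp only [Finset.sum_const, Finset.card_univ, Fintype.card_fin, nsmul_eq_mul,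
          ← Finset.mul_sum, Finset.sum_add_distrib]
        ring
    _ ≤ _ := by
        rw [hkr, one_mul, sum_sq_apply_single]
        gcongr
        exact hL z

lemma isoProfile_integral_cubeLaw_le (hw : ∀ x, HasFDerivAt w (w' x) x) (hL : ∀ x, ‖w' x‖ ≤ L)
    (hC0 : 0 ≤ C) (hC : ∀ x y, ‖w' x - w' y‖ ≤ C * ‖x - y‖) {k : ℕ} (hk : 0 < k) :
    isoProfile (∫ z, stdCDF (w z) ∂(cubeLaw n k : Measure (EuclideanSpace ℝ (Fin n)))) ≤
      √(1 + L ^ 2) * ∫ z, stdPDF (w z) ∂(cubeLaw n k : Measure (EuclideanSpace ℝ (Fin n))) +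
        √(n * (4 * (C + L ^ 2) * L + 4 * (C + L ^ 2) ^ 2) * (√k)⁻¹) := by
  have hwc : Continuous w := continuous_iff_continuousAt.2 fun x => (hw x).continuousAt
  set R := n * (4 * (C + L ^ 2) * L + 4 * (C + L ^ 2) ^ 2) * (√(k : ℝ))⁻¹
  have hL0 : 0 ≤ L := (norm_nonneg _).trans (hL 0)
  have hR : 0 ≤ R := by positivity
  rw [integral_cubeLaw_real n k (F := fun z => stdCDF (w z)) (continuous_stdCDF.comp hwc),
    integral_cubeLaw_real n k (F := fun z => stdPDF (w z)) (continuous_stdPDF.comp hwc)]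
  refine (isoProfile_cubeAvg_le _ fun x => stdCDF_mem_Ioo _).trans ?_
  have hlin : √(1 + L ^ 2) * cubeAvg (fun x => stdPDF (w (cubeSum n k x))) + √R =
      cubeAvg fun x => √(1 + L ^ 2) * stdPDF (w (cubeSum n k x)) + √R := by
    simp [cubeAvg, Finset.sum_add_distrib, ← Finset.mul_sum, add_div, mul_div_assoc]
  rw [hlin]
  refine cubeAvg_mono fun x => ?_
  have hp := (stdPDF_pos (w (cubeSum n k x))).le
  rw [isoProfile_stdCDF]
  refine (Real.sqrt_le_sqrt (add_le_add_right
    (cubeGradSq_stdCDF_comp_le hw hL hC0 hC hk x) _)).trans ?_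
  rw [← add_assoc]
  refine (sqrt_add_le_sqrt_add_sqrt (by positivity) hR).trans_eq ?_
  congr 1
  rw [show stdPDF (w (cubeSum n k x)) ^ 2 + stdPDF (w (cubeSum n k x)) ^ 2 * L ^ 2 =
    (1 + L ^ 2) * stdPDF (w (cubeSum n k x)) ^ 2 by ring, Real.sqrt_mul (by positivity),
    Real.sqrt_sq hp]

lemma tendsto_integral_cubeLaw {F : EuclideanSpace ℝ (Fin n) → ℝ} (hF : Continuous F)
    (hF1 : ∀ z, |F z| ≤ 1) :
    Tendsto (fun k => ∫ z, F z ∂(cubeLaw n k : Measure (EuclideanSpace ℝ (Fin n)))) atTop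
      (𝓝 (∫ z, F z ∂stdGaussian (EuclideanSpace ℝ (Fin n)))) :=
  ProbabilityMeasure.tendsto_iff_forall_integral_tendsto.1 (tendsto_cubeLaw n)
    (BoundedContinuousFunction.ofNormedAddCommGroup F hF 1 hF1)

lemma integrable_stdCDF_comp {Ω : Type*} [MeasurableSpace Ω] (μ : Measure Ω)
    [IsProbabilityMeasure μ] {u : Ω → ℝ} (hu : Measurable u) :
    Integrable (fun z => stdCDF (u z)) μ :=
  Integrable.of_bound (continuous_stdCDF.measurable.comp hu).aestronglyMeasurable 1
    (ae_of_all _ fun z => abs_le.2 ⟨by linarith [(stdCDF_mem_Ioo (u z)).1],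
      (stdCDF_mem_Ioo (u z)).2.le⟩)

lemma integral_stdCDF_mem_Ioo {Ω : Type*} [MeasurableSpace Ω] (μ : Measure Ω)
    [IsProbabilityMeasure μ] {u : Ω → ℝ} (hu : Measurable u) :
    ∫ z, stdCDF (u z) ∂μ ∈ Ioo (0 : ℝ) 1 := by
  have hint := integrable_stdCDF_comp μ hu
  have hpos : ∀ g : Ω → ℝ, Integrable g μ → (∀ z, 0 < g z) → 0 < ∫ z, g z ∂μ := by
    intro g hg hg0
    rw [integral_pos_iff_support_of_nonneg (fun z => (hg0 z).le) hg,
      show Function.support g = univ from eq_univ_of_forall fun z => (hg0 z).ne']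
    simp
  refine ⟨hpos _ hint fun z => (stdCDF_mem_Ioo _).1, ?_⟩
  have := hpos _ ((integrable_const 1).sub hint) fun z => sub_pos.2 (stdCDF_mem_Ioo (u z)).2
  simp only [Pi.sub_apply] at this
  rw [integral_sub (integrable_const 1) hint] at this
  simpa using this

/-- Bobkov's Gaussian inequality for a smooth function of the form `stdCDF ∘ w`. -/
lemma isoProfile_integral_stdCDF_le (hw : ∀ x, HasFDerivAt w (w' x) x) (hL : ∀ x, ‖w' x‖ ≤ L)
    (hC0 : 0 ≤ C) (hC : ∀ x y, ‖w' x - w' y‖ ≤ C * ‖x - y‖) :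
    isoProfile (∫ z, stdCDF (w z) ∂stdGaussian (EuclideanSpace ℝ (Fin n))) ≤
      √(1 + L ^ 2) * ∫ z, stdPDF (w z) ∂stdGaussian (EuclideanSpace ℝ (Fin n)) := by
  have hwc : Continuous w := continuous_iff_continuousAt.2 fun x => (hw x).continuousAt
  have h1 := tendsto_integral_cubeLaw (F := fun z => stdCDF (w z))
    (continuous_stdCDF.comp hwc) fun z => abs_le.2
      ⟨by linarith [(stdCDF_mem_Ioo (w z)).1], (stdCDF_mem_Ioo (w z)).2.le⟩
  have h2 := tendsto_integral_cubeLaw (F := fun z => stdPDF (w z))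
    (continuous_stdPDF.comp hwc) fun z => abs_le.2
      ⟨by linarith [stdPDF_pos (w z)], stdPDF_le_one (w z)⟩
  have h3 : Tendsto (fun k : ℕ => √(n * (4 * (C + L ^ 2) * L + 4 * (C + L ^ 2) ^ 2) * (√k)⁻¹))
      atTop (𝓝 0) := by
    have : Tendsto (fun k : ℕ => (√(k : ℝ))⁻¹) atTop (𝓝 0) :=
      tendsto_inv_atTop_zero.comp (Real.tendsto_sqrt_atTop.comp tendsto_natCast_atTop_atTop)
    have := (this.const_mul (n * (4 * (C + L ^ 2) * L + 4 * (C + L ^ 2) ^ 2))).sqrt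
    simpa using this
  have h4 := (h2.const_mul √(1 + L ^ 2)).add h3
  rw [add_zero] at h4
  exact le_of_tendsto_of_tendsto
    ((continuousAt_isoProfile (integral_stdCDF_mem_Ioo _ hwc.measurable)).tendsto.comp h1) h4
    (eventually_atTop.2 ⟨1, fun k hk => isoProfile_integral_cubeLaw_le hw hL hC0 hC hk⟩)

end Smooth

section Layers

variable {Ω : Type*} [MeasurableSpace Ω] (μ : Measure Ω) [IsProbabilityMeasure μ] {f : Ω → ℝ}

lemma integrable_stdPDF_comp {u : Ω → ℝ} (hu : Measurable u) :
    Integrable (fun z => stdPDF (u z)) μ :=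
  Integrable.of_bound (continuous_stdPDF.measurable.comp hu).aestronglyMeasurable 1
    (ae_of_all _ fun z => abs_le.2 ⟨by linarith [stdPDF_pos (u z)], stdPDF_le_one (u z)⟩)

lemma hasDerivAt_integral_stdCDF (hf : Measurable f) {L : ℝ} (hL : 0 ≤ L) (a : ℝ) :
    HasDerivAt (fun a => ∫ z, stdCDF (L * (a - f z)) ∂μ)
      (L * ∫ z, stdPDF (L * (a - f z)) ∂μ) a := by
  have hm : ∀ a, Measurable fun z => L * (a - f z) := fun a => (hf.const_sub a).const_mul L
  rw [← integral_const_mul]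
  refine (hasDerivAt_integral_of_dominated_loc_of_deriv_le (bound := fun _ => L)
    (F' := fun b z => L * stdPDF (L * (b - f z))) univ_mem
    (Eventually.of_forall fun a => (integrable_stdCDF_comp μ (hm a)).aestronglyMeasurable)
    (integrable_stdCDF_comp μ (hm a))
    ((integrable_stdPDF_comp μ (hm a)).const_mul L).aestronglyMeasurable
    (ae_of_all _ fun z b _ => ?_) (integrable_const _) (ae_of_all _ fun z b _ => ?_)).2
  · rw [Real.norm_of_nonneg (mul_nonneg hL (stdPDF_pos _).le)]
    exact mul_le_of_le_one_right hL (stdPDF_le_one _)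
  · have := (hasDerivAt_stdCDF (L * (b - f z))).comp b
      (((hasDerivAt_id b).sub_const (f z)).const_mul L)
    rw [mul_one, mul_comm] at this
    exact this

lemma stdCDF_half_le_integral (hf : Measurable f) {L m η : ℝ} (hL : 0 ≤ L)
    (hm : 1 / 2 ≤ μ.real {z | f z ≤ m}) :
    stdCDF (L * η) / 2 ≤ ∫ z, stdCDF (L * (m + η - f z)) ∂μ := by
  have hs : MeasurableSet {z | f z ≤ m} := measurableSet_le hf measurable_const
  have h0 := (stdCDF_mem_Ioo (L * η)).1
  calc stdCDF (L * η) / 2 ≤ μ.real {z | f z ≤ m} * stdCDF (L * η) := by nlinarith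
    _ = ∫ z, {z | f z ≤ m}.indicator (fun _ => stdCDF (L * η)) z ∂μ := by
      rw [integral_indicator_const _ hs, smul_eq_mul]
    _ ≤ _ := by
      refine integral_mono ((integrable_const _).indicator hs)
        (integrable_stdCDF_comp μ ((hf.const_sub _).const_mul L)) fun z => ?_
      by_cases hz : f z ≤ m
      · rw [indicator_of_mem (show z ∈ {z | f z ≤ m} from hz)]
        exact strictMono_stdCDF.monotone (mul_le_mul_of_nonneg_left (by linarith) hL)
      · rw [indicator_of_notMem (show z ∉ {z | f z ≤ m} from hz)]
        exact (stdCDF_mem_Ioo _).1.le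

lemma integral_stdCDF_le_measureReal_add (hf : Measurable f) {L b η : ℝ} (hL : 0 ≤ L) :
    ∫ z, stdCDF (L * (b - η - f z)) ∂μ ≤ μ.real {z | f z < b} + stdCDF (-(L * η)) := by
  have hs : MeasurableSet {z | f z < b} := measurableSet_lt hf measurable_const
  have h0 := (stdCDF_mem_Ioo (-(L * η))).1
  calc _ ≤ ∫ z, ({z | f z < b}.indicator (fun _ => (1 : ℝ)) z + stdCDF (-(L * η))) ∂μ := by
        refine integral_mono (integrable_stdCDF_comp μ ((hf.const_sub _).const_mul L))
          (((integrable_const _).indicator hs).add (integrable_const _)) fun z => ?_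
        by_cases hz : f z < b
        · rw [indicator_of_mem (show z ∈ {z | f z < b} from hz)]
          linarith [(stdCDF_mem_Ioo (L * (b - η - f z))).2]
        · rw [indicator_of_notMem (show z ∉ {z | f z < b} from hz), zero_add]
          refine strictMono_stdCDF.monotone ?_
          nlinarith [mul_le_mul_of_nonneg_left (not_lt.1 hz) hL]
    _ = _ := by
      rw [integral_add ((integrable_const _).indicator hs) (integrable_const _),
        integral_indicator_const _ hs]
      simp

end Layers

section SmoothConcentration

variable {n : ℕ} {f : EuclideanSpace ℝ (Fin n) → ℝ}
  {f' : EuclideanSpace ℝ (Fin n) → EuclideanSpace ℝ (Fin n) →L[ℝ] ℝ} {C : ℝ}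

lemma mul_sub_le_stdQuantile_integral_sub (hf : ∀ x, HasFDerivAt f (f' x) x)
    (hf1 : ∀ x, ‖f' x‖ ≤ 1) (hC0 : 0 ≤ C) (hC : ∀ x y, ‖f' x - f' y‖ ≤ C * ‖x - y‖)
    {L : ℝ} (hL : 0 < L) {a b : ℝ} (hab : a ≤ b) :
    (√(1 + L⁻¹ ^ 2))⁻¹ * (b - a) ≤
      stdQuantile (∫ z, stdCDF (L * (b - f z)) ∂stdGaussian (EuclideanSpace ℝ (Fin n))) -
      stdQuantile (∫ z, stdCDF (L * (a - f z)) ∂stdGaussian (EuclideanSpace ℝ (Fin n))) := by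
  set γ := stdGaussian (EuclideanSpace ℝ (Fin n))
  have hfm : Measurable f :=
    (continuous_iff_continuousAt.2 fun x => (hf x).continuousAt).measurable
  have hm : ∀ a, Measurable fun z => L * (a - f z) := fun a => (hfm.const_sub a).const_mul L
  have hderiv : ∀ a, HasDerivAt (fun a => stdQuantile (∫ z, stdCDF (L * (a - f z)) ∂γ))
      ((isoProfile (∫ z, stdCDF (L * (a - f z)) ∂γ))⁻¹ *
        (L * ∫ z, stdPDF (L * (a - f z)) ∂γ)) a := fun a =>
    HasDerivAt.comp (h₂ := stdQuantile) a
      (hasDerivAt_stdQuantile (integral_stdCDF_mem_Ioo γ (hm a)))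
      (hasDerivAt_integral_stdCDF γ hfm hL.le a)
  refine mul_sub_le_image_sub_of_le_deriv (fun a => (hderiv a).differentiableAt) (fun a => ?_) hab
  rw [(hderiv a).deriv]
  have hpos := isoProfile_pos (∫ z, stdCDF (L * (a - f z)) ∂γ)
  have key := isoProfile_integral_stdCDF_le (w := fun z => L * (a - f z))
    (w' := fun z => L • -f' z) (L := L) (C := L * C)
    (fun z => ((hf z).const_sub a).const_mul L)
    (fun z => by
      rw [norm_smul, norm_neg, Real.norm_of_nonneg hL.le]
      exact mul_le_of_le_one_right hL.le (hf1 z))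
    (by positivity)
    (fun x y => by
      rw [show L • -f' x - L • -f' y = L • (f' y - f' x) by module, norm_smul,
        Real.norm_of_nonneg hL.le, norm_sub_rev, mul_assoc]
      exact mul_le_mul_of_nonneg_left (hC x y) hL.le)
  have hsq : √(1 + L ^ 2) = L * √(1 + L⁻¹ ^ 2) := by
    rw [← Real.sqrt_sq hL.le, ← Real.sqrt_mul (by positivity), Real.sqrt_sq hL.le]
    congr 1
    field_simp
    ring
  have hs : 0 < √(1 + L⁻¹ ^ 2) := by positivity
  rw [hsq] at key
  rw [inv_mul_eq_div, inv_eq_one_div, div_le_div_iff₀ hs hpos, one_mul]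
  calc _ ≤ _ := key
    _ = _ := by ring

lemma stdCDF_zero : stdCDF 0 = 1 / 2 := by
  have := stdCDF_neg 0
  rw [neg_zero] at this
  linarith

lemma stdCDF_le_measureReal_of_smooth (hf : ∀ x, HasFDerivAt f (f' x) x)
    (hf1 : ∀ x, ‖f' x‖ ≤ 1) (hC0 : 0 ≤ C) (hC : ∀ x y, ‖f' x - f' y‖ ≤ C * ‖x - y‖) {m x : ℝ}
    (hm : 1 / 2 ≤ (stdGaussian (EuclideanSpace ℝ (Fin n))).real {z | f z ≤ m}) (hx : 0 < x) :
    stdCDF x ≤ (stdGaussian (EuclideanSpace ℝ (Fin n))).real {z | f z < m + x} := by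
  set γ := stdGaussian (EuclideanSpace ℝ (Fin n))
  have hfm : Measurable f :=
    (continuous_iff_continuousAt.2 fun x => (hf x).continuousAt).measurable
  have hmem : (1 / 2 : ℝ) ∈ Ioo 0 1 := by norm_num
  have hη : ∀ η, 0 < η → 2 * η ≤ x → stdCDF (x - 2 * η) ≤ γ.real {z | f z < m + x} := by
    intro η hη0 hηx
    have hbound : ∀ L : ℝ, 0 < L →
        stdCDF (stdQuantile (stdCDF (L * η) / 2) + (√(1 + L⁻¹ ^ 2))⁻¹ * (x - 2 * η)) ≤
          γ.real {z | f z < m + x} + stdCDF (-(L * η)) := by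
      intro L hL
      have hmem' : ∀ a, ∫ z, stdCDF (L * (a - f z)) ∂γ ∈ Ioo 0 1 := fun a =>
        integral_stdCDF_mem_Ioo γ ((hfm.const_sub a).const_mul L)
      have h1 := stdCDF_half_le_integral γ hfm (η := η) hL.le hm
      have h2 := integral_stdCDF_le_measureReal_add γ hfm (b := m + x) (η := η) hL.le
      have h3 := mul_sub_le_stdQuantile_integral_sub hf hf1 hC0 hC hL
        (show m + η ≤ m + x - η by linarith)
      have h4 := (strictMonoOn_stdQuantile.monotoneOn
        ⟨half_pos (stdCDF_mem_Ioo (L * η)).1, by linarith [(stdCDF_mem_Ioo (L * η)).2]⟩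
        (hmem' (m + η))) h1
      rw [show m + x - η - (m + η) = x - 2 * η by ring] at h3
      refine le_trans ?_ h2
      rw [← stdCDF_stdQuantile (hmem' (m + x - η))]
      exact strictMono_stdCDF.monotone (by linarith)
    have hLη : Tendsto (fun L : ℝ => L * η) atTop atTop := tendsto_id.atTop_mul_const hη0
    have hQ : Tendsto (fun L : ℝ => stdQuantile (stdCDF (L * η) / 2)) atTop (𝓝 0) := by
      have h := (hasDerivAt_stdQuantile hmem).continuousAt.tendsto.comp
        ((tendsto_stdCDF_atTop.comp hLη).div_const 2)
      rwa [← stdCDF_zero, stdQuantile_stdCDF] at h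
    have hc : Tendsto (fun L : ℝ => (√(1 + L⁻¹ ^ 2))⁻¹) atTop (𝓝 1) := by
      have h := (((tendsto_inv_atTop_zero (𝕜 := ℝ)).pow 2).const_add 1).sqrt.inv₀ (by simp)
      simpa using h
    have hl := (continuous_stdCDF.tendsto _).comp (hQ.add (hc.mul_const (x - 2 * η)))
    have hr := (tendsto_stdCDF_atBot.comp (tendsto_neg_atTop_atBot.comp hLη)).const_add
      (γ.real {z | f z < m + x})
    rw [zero_add, one_mul] at hl
    rw [add_zero] at hr
    exact le_of_tendsto_of_tendsto hl hr ((eventually_gt_atTop 0).mono hbound)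
  have hlim : Tendsto (fun η => stdCDF (x - 2 * η)) (𝓝[>] 0) (𝓝 (stdCDF x)) := by
    have : Continuous fun η => stdCDF (x - 2 * η) := continuous_stdCDF.comp (by fun_prop)
    simpa using (this.tendsto 0).mono_left nhdsWithin_le_nhds
  refine le_of_tendsto hlim ?_
  filter_upwards [Ioo_mem_nhdsGT (half_pos hx)] with η hη'
  exact hη η hη'.1 (by linarith [hη'.2])

end SmoothConcentration

open scoped Convolution

section Mollification

variable {V : Type*} [NormedAddCommGroup V] [InnerProductSpace ℝ V] [FiniteDimensional ℝ V]
  [MeasurableSpace V] [BorelSpace V] {f : V → ℝ}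

lemma norm_convolution_sub_convolution_le {F G : Type*} [NormedAddCommGroup F] [NormedSpace ℝ F]
    [NormedAddCommGroup G] [NormedSpace ℝ G] (B : F →L[ℝ] ℝ →L[ℝ] G) {ρ : V → F}
    (hρ : Continuous ρ) (hρs : HasCompactSupport ρ) (hf : LipschitzWith 1 f) (x y : V) :
    ‖(ρ ⋆[B, volume] f) x - (ρ ⋆[B, volume] f) y‖ ≤ (‖B‖ * ∫ t, ‖ρ t‖) * ‖x - y‖ := by
  have hex := hρs.convolutionExists_left (μ := volume) B hρ hf.continuous.locallyIntegrable
  rw [convolution_def, convolution_def, ← integral_sub (hex x) (hex y), ← integral_const_mul,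
    ← integral_mul_const]
  refine norm_integral_le_of_norm_le
    (((hρ.integrable_of_hasCompactSupport hρs).norm.const_mul _).mul_const _)
    (ae_of_all _ fun t => ?_)
  rw [← map_sub]
  refine (B.le_opNorm₂ _ _).trans ?_
  gcongr
  have := hf.dist_le_mul (x - t) (y - t)
  rwa [dist_sub_right, NNReal.coe_one, one_mul, dist_eq_norm, dist_eq_norm] at this

lemma exists_smooth_approx (hf : LipschitzWith 1 f) {δ : ℝ} (hδ : 0 < δ) :
    ∃ (g : V → ℝ) (g' : V → V →L[ℝ] ℝ) (C : ℝ), 0 ≤ C ∧ (∀ x, HasFDerivAt g (g' x) x) ∧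
      (∀ x, ‖g' x‖ ≤ 1) ∧ (∀ x y, ‖g' x - g' y‖ ≤ C * ‖x - y‖) ∧ ∀ x, |g x - f x| ≤ δ := by
  let φ : ContDiffBump (0 : V) := ⟨δ / 2, δ, half_pos hδ, half_lt_self hδ⟩
  set ρ : V → ℝ := φ.normed volume
  have hρ : ContDiff ℝ 1 ρ := φ.contDiff_normed
  have hρs : HasCompactSupport ρ := φ.hasCompactSupport_normed
  set B := ContinuousLinearMap.lsmul ℝ ℝ (E := ℝ)
  have hderiv := hρs.hasFDerivAt_convolution_left (μ := volume) B hρ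
    hf.continuous.locallyIntegrable
  refine ⟨ρ ⋆[B, volume] f, _, _,
    mul_nonneg (ContinuousLinearMap.opNorm_nonneg _) (integral_nonneg fun _ => norm_nonneg _),
    hderiv, fun x => ?_, norm_convolution_sub_convolution_le (B.precompL V)
      (hρ.continuous_fderiv one_ne_zero) (hρs.fderiv ℝ) hf, fun x => ?_⟩
  · refine (hderiv x).le_of_lipschitz (C := 1) (LipschitzWith.of_dist_le_mul fun x y => ?_)
    rw [dist_eq_norm, dist_eq_norm]
    refine (norm_convolution_sub_convolution_le B hρ.continuous hρs hf x y).trans ?_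
    gcongr
    have h1 : ∫ t, ‖ρ t‖ = 1 :=
      (integral_congr_ae (ae_of_all _ fun t => Real.norm_of_nonneg (φ.nonneg_normed t))).trans
        φ.integral_normed
    rw [h1, mul_one]
    exact ContinuousLinearMap.opNorm_lsmul_le
  · refine φ.dist_normed_convolution_le hf.continuous.aestronglyMeasurable fun y hy => ?_
    refine (hf.dist_le_mul y x).trans ?_
    rw [NNReal.coe_one, one_mul]
    exact (Metric.mem_ball.1 hy).le

end Mollification

section Concentration

variable {n : ℕ} {f : EuclideanSpace ℝ (Fin n) → ℝ}

lemma stdCDF_le_measureReal_of_lipschitz (hf : LipschitzWith 1 f) {m x : ℝ}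
    (hm : 1 / 2 ≤ (stdGaussian (EuclideanSpace ℝ (Fin n))).real {z | f z ≤ m}) (hx : 0 < x) :
    stdCDF x ≤ (stdGaussian (EuclideanSpace ℝ (Fin n))).real {z | f z < m + x} := by
  have hlim : Tendsto (fun δ => stdCDF (x - 2 * δ)) (𝓝[>] 0) (𝓝 (stdCDF x)) := by
    have : Continuous fun δ => stdCDF (x - 2 * δ) := continuous_stdCDF.comp (by fun_prop)
    simpa using (this.tendsto 0).mono_left nhdsWithin_le_nhds
  refine le_of_tendsto hlim ?_
  filter_upwards [Ioo_mem_nhdsGT (half_pos hx)] with δ ⟨hδ0, hδx⟩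
  obtain ⟨g, g', C, hC0, hg, hg1, hC, hgf⟩ := exists_smooth_approx hf hδ0
  have hm' : 1 / 2 ≤ (stdGaussian (EuclideanSpace ℝ (Fin n))).real {z | g z ≤ m + δ} :=
    hm.trans (measureReal_mono fun z (hz : f z ≤ m) => show g z ≤ m + δ by
      linarith [(abs_le.1 (hgf z)).2])
  refine (stdCDF_le_measureReal_of_smooth hg hg1 hC0 hC hm' (x := x - 2 * δ) (by linarith)).trans
    (measureReal_mono fun z (hz : g z < m + δ + (x - 2 * δ)) => show f z < m + x by
      linarith [(abs_le.1 (hgf z)).1])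

/-- Gaussian concentration of a `1`-Lipschitz function above a median. -/
lemma stdGaussian_le_gaussianReal_Ici_of_lipschitz (hf : LipschitzWith 1 f) {m x : ℝ}
    (hm : ENNReal.ofReal (1 / 2) ≤ stdGaussian (EuclideanSpace ℝ (Fin n)) {z | f z ≤ m})
    (hx : 0 < x) :
    stdGaussian (EuclideanSpace ℝ (Fin n)) {z | m + x ≤ f z} ≤ gaussianReal 0 1 (Ici x) := by
  have hs : MeasurableSet {z | f z < m + x} :=
    measurableSet_lt hf.continuous.measurable measurable_const
  have hc : {z | m + x ≤ f z} = {z | f z < m + x}ᶜ := by ext; simp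
  rw [gaussianReal_Ici_eq, ← ofReal_measureReal, hc, probReal_compl_eq_one_sub hs]
  refine ENNReal.ofReal_le_ofReal (sub_le_sub_left
    (stdCDF_le_measureReal_of_lipschitz hf ?_ hx) 1)
  rwa [measureReal_def, ← ENNReal.ofReal_le_iff_le_toReal (measure_ne_top _ _)]

/-- Gaussian concentration of a `1`-Lipschitz function below a median. -/
lemma stdGaussian_le_gaussianReal_Iic_of_lipschitz (hf : LipschitzWith 1 f) {m x : ℝ}
    (hm : ENNReal.ofReal (1 / 2) ≤ stdGaussian (EuclideanSpace ℝ (Fin n)) {z | m ≤ f z})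
    (hx : 0 < x) :
    stdGaussian (EuclideanSpace ℝ (Fin n)) {z | f z ≤ m - x} ≤ gaussianReal 0 1 (Iic (-x)) := by
  have h := stdGaussian_le_gaussianReal_Ici_of_lipschitz (f := fun z => -f z) hf.neg (m := -m)
    (by simpa using hm) hx
  rw [gaussianReal_Iic_neg]
  convert h using 3
  ext z
  constructor <;> intro <;> linarith

end Concentration

section Transfer

variable {n : ℕ}

lemma map_stdGaussian_mul (σ : ℝ≥0) :
    (stdGaussian (EuclideanSpace ℝ (Fin n))).map (fun z i => (σ : ℝ) * z i) =
      Measure.pi fun _ => gaussianReal 0 (σ ^ 2) := by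
  have h : (gaussianReal 0 1).map ((σ : ℝ) * ·) = gaussianReal 0 (σ ^ 2) := by
    rw [gaussianReal_map_const_mul, mul_zero, mul_one]
    rfl
  rw [← map_pi_eq_stdGaussian, Measure.map_map (by fun_prop) (by fun_prop), ← h]
  exact (Measure.pi_map_pi (f := fun _ => ((σ : ℝ) * ·)) fun _ => by fun_prop)

variable {f : (Fin n → ℝ) → ℝ} {Ω : Type*} [MeasurableSpace Ω] {P : Measure Ω} {σ : ℝ≥0}
  {ε : Ω → Fin n → ℝ}

lemma measure_preimage_eq_stdGaussian (hε : Measurable ε)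
    (hgauss : P.map ε = Measure.pi fun _ => gaussianReal 0 (σ ^ 2)) {s : Set (Fin n → ℝ)}
    (hs : MeasurableSet s) :
    P (ε ⁻¹' s) = stdGaussian (EuclideanSpace ℝ (Fin n)) {z | (fun i => (σ : ℝ) * z i) ∈ s} := by
  rw [← Measure.map_apply hε hs, hgauss, ← map_stdGaussian_mul, Measure.map_apply (by fun_prop) hs]
  rfl

lemma lipschitzWith_scaled (hf : LipschitzWith 1 fun z : EuclideanSpace ℝ (Fin n) => f z.ofLp)
    (hσ : 0 < σ) :
    LipschitzWith 1 fun z : EuclideanSpace ℝ (Fin n) => f (fun i => (σ : ℝ) * z i) / σ := by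
  have hσ' : (0 : ℝ) < σ := hσ
  refine LipschitzWith.of_dist_le_mul fun x y => ?_
  have h := hf.dist_le_mul ((σ : ℝ) • x) ((σ : ℝ) • y)
  rw [dist_smul₀, Real.norm_of_nonneg hσ'.le, NNReal.coe_one, one_mul, Real.dist_eq] at h
  rw [NNReal.coe_one, one_mul, Real.dist_eq, ← sub_div, abs_div, abs_of_pos hσ',
    div_le_iff₀ hσ', mul_comm]
  exact h

lemma gaussian_concentration_of_lipschitz
    (hf : LipschitzWith 1 fun z : EuclideanSpace ℝ (Fin n) => f z.ofLp) (hσ : 0 < σ)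
    (hε : Measurable ε) (hgauss : P.map ε = Measure.pi fun _ => gaussianReal 0 (σ ^ 2)) {m x : ℝ}
    (hx : 0 < x) (hm₁ : ENNReal.ofReal (1 / 2) ≤ P {ω | f (ε ω) ≤ m})
    (hm₂ : ENNReal.ofReal (1 / 2) ≤ P {ω | m ≤ f (ε ω)}) :
    P {ω | m + σ * x ≤ f (ε ω)} ≤ gaussianReal 0 1 (Ici x) ∧
      P {ω | f (ε ω) ≤ m - σ * x} ≤ gaussianReal 0 1 (Iic (-x)) := by
  have hσ' : (0 : ℝ) < σ := hσ
  have hfm : Measurable f := by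
    have h : Measurable fun v : Fin n → ℝ => f (WithLp.toLp 2 v).ofLp :=
      hf.continuous.measurable.comp (by fun_prop)
    exact h
  have hlaw : ∀ (s : Set ℝ), MeasurableSet s → P {ω | f (ε ω) ∈ s} =
      stdGaussian (EuclideanSpace ℝ (Fin n)) {z | f (fun i => (σ : ℝ) * z i) ∈ s} := fun s hs =>
    measure_preimage_eq_stdGaussian hε hgauss (hfm hs)
  have hle : ∀ a b : ℝ, a / σ ≤ b / σ ↔ a ≤ b := fun a b => div_le_div_iff_of_pos_right hσ'
  have hadd : m / σ + x = (m + σ * x) / σ := by field_simp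
  have hsub : m / σ - x = (m - σ * x) / σ := by field_simp
  have hg := lipschitzWith_scaled hf hσ
  constructor
  · have h := stdGaussian_le_gaussianReal_Ici_of_lipschitz hg (m := m / σ)
      (by simp only [hle]; exact hm₁.trans_eq (hlaw _ measurableSet_Iic)) hx
    simp only [hadd, hle] at h
    exact (hlaw _ measurableSet_Ici).trans_le h
  · have h := stdGaussian_le_gaussianReal_Iic_of_lipschitz hg (m := m / σ)
      (by simp only [hle]; exact hm₂.trans_eq (hlaw _ measurableSet_Ici)) hx
    simp only [hsub, hle] at h
    exact (hlaw _ measurableSet_Iic).trans_le h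

end Transfer

section Proximal

lemma inner_sub_le_of_isMin_segment {V : Type*} [NormedAddCommGroup V] [InnerProductSpace ℝ V]
    {u w y : V} {a b : ℝ}
    (h : ∀ t : ℝ, 0 < t → t ≤ 1 → ‖u - y‖ ^ 2 + 2 * a ≤
      ‖t • w + (1 - t) • u - y‖ ^ 2 + 2 * (t * b + (1 - t) * a)) :
    inner ℝ (y - u) (w - u) ≤ b - a := by
  have key : ∀ t : ℝ, 0 < t → t ≤ 1 →
      inner ℝ (y - u) (w - u) ≤ b - a + t * (‖w - u‖ ^ 2 / 2) := by
    intro t ht0 ht1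
    have ht := h t ht0 ht1
    rw [show t • w + (1 - t) • u - y = t • (w - u) - (y - u) by module,
      norm_sub_rev u y, norm_sub_sq_real (t • (w - u)), norm_smul, real_inner_smul_left,
      Real.norm_of_nonneg ht0.le, real_inner_comm] at ht
    refine le_of_mul_le_mul_left ?_ ht0
    linarith
  have hlim : Tendsto (fun t : ℝ => b - a + t * (‖w - u‖ ^ 2 / 2)) (𝓝[>] 0) (𝓝 (b - a)) := by
    have : Continuous fun t : ℝ => b - a + t * (‖w - u‖ ^ 2 / 2) := by fun_prop
    simpa using (this.tendsto 0).mono_left nhdsWithin_le_nhds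
  refine ge_of_tendsto hlim ?_
  filter_upwards [Ioc_mem_nhdsGT zero_lt_one] with t ht
  exact key t ht.1 ht.2

lemma norm_sub_le_of_inner_le {V : Type*} [NormedAddCommGroup V] [InnerProductSpace ℝ V]
    {u₁ u₂ y₁ y₂ : V} {a : ℝ} (h₁ : inner ℝ (y₁ - u₁) (u₂ - u₁) ≤ a)
    (h₂ : inner ℝ (y₂ - u₂) (u₁ - u₂) ≤ -a) : ‖u₁ - u₂‖ ≤ ‖y₁ - y₂‖ := by
  have h : ‖u₁ - u₂‖ ^ 2 ≤ inner ℝ (y₁ - y₂) (u₁ - u₂) := by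
    rw [← neg_sub u₁ u₂, inner_neg_right] at h₁
    rw [← real_inner_self_eq_norm_sq]
    simp only [inner_sub_left] at *
    linarith
  have := h.trans (real_inner_le_norm _ _)
  nlinarith [norm_nonneg (u₁ - u₂), norm_nonneg (y₁ - y₂)]

lemma l2norm_eq_norm {k : ℕ} (v : Fin k → ℝ) : l2norm v = ‖WithLp.toLp 2 v‖ := by
  simp [l2norm, EuclideanSpace.norm_eq]

variable {n p : ℕ} {X : Matrix (Fin n) (Fin p) ℝ} {h : (Fin p → ℝ) → ℝ≥0∞}

lemma inner_residual_le {y : Fin n → ℝ} {β b : Fin p → ℝ}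
    (hconv : ∀ b₁ b₂ : Fin p → ℝ, ∀ a : ℝ, 0 ≤ a → a ≤ 1 →
      h (a • b₁ + (1 - a) • b₂) ≤ ENNReal.ofReal a * h b₁ + ENNReal.ofReal (1 - a) * h b₂)
    (hβ : ∀ b, ENNReal.ofReal (l2norm (X.mulVec β - y) ^ 2) + 2 * h β ≤
      ENNReal.ofReal (l2norm (X.mulVec b - y) ^ 2) + 2 * h b)
    (hβfin : h β ≠ ⊤) (hb : h b ≠ ⊤) :
    inner ℝ (WithLp.toLp 2 y - WithLp.toLp 2 (X.mulVec β))
      (WithLp.toLp 2 (X.mulVec b) - WithLp.toLp 2 (X.mulVec β)) ≤ (h b).toReal - (h β).toReal := by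
  refine inner_sub_le_of_isMin_segment fun t ht0 ht1 => ?_
  have h1 : (0 : ℝ) ≤ 1 - t := sub_nonneg.2 ht1
  have hle := (hβ (t • b + (1 - t) • β)).trans
    (add_le_add_right (mul_le_mul_right (hconv b β t ht0.le ht1) 2) _)
  lift h b to ℝ≥0 using hb with hb'
  lift h β to ℝ≥0 using hβfin with hβ'
  have hlin : WithLp.toLp 2 (X.mulVec (t • b + (1 - t) • β) - y) =
      t • WithLp.toLp 2 (X.mulVec b) + (1 - t) • WithLp.toLp 2 (X.mulVec β) - WithLp.toLp 2 y := by
    rw [Matrix.mulVec_add, Matrix.mulVec_smul, Matrix.mulVec_smul]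
    rfl
  rw [l2norm_eq_norm, l2norm_eq_norm, hlin, WithLp.toLp_sub] at hle
  have hreal := ENNReal.toReal_mono (by finiteness) hle
  rwa [ENNReal.toReal_add (by finiteness) (by finiteness),
    ENNReal.toReal_add (by finiteness) (by finiteness), ENNReal.toReal_mul, ENNReal.toReal_mul,
    ENNReal.toReal_add (by finiteness) (by finiteness), ENNReal.toReal_mul, ENNReal.toReal_mul,
    ENNReal.toReal_ofReal (by positivity), ENNReal.toReal_ofReal (by positivity),
    ENNReal.toReal_ofReal ht0.le, ENNReal.toReal_ofReal h1, ENNReal.toReal_ofNat] at hreal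

lemma norm_fit_sub_fit_le {y₁ y₂ : Fin n → ℝ} {β₁ β₂ : Fin p → ℝ}
    (hconv : ∀ b₁ b₂ : Fin p → ℝ, ∀ a : ℝ, 0 ≤ a → a ≤ 1 →
      h (a • b₁ + (1 - a) • b₂) ≤ ENNReal.ofReal a * h b₁ + ENNReal.ofReal (1 - a) * h b₂)
    (hproper : ∃ b, h b ≠ ⊤)
    (hβ₁ : ∀ b, ENNReal.ofReal (l2norm (X.mulVec β₁ - y₁) ^ 2) + 2 * h β₁ ≤
      ENNReal.ofReal (l2norm (X.mulVec b - y₁) ^ 2) + 2 * h b)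
    (hβ₂ : ∀ b, ENNReal.ofReal (l2norm (X.mulVec β₂ - y₂) ^ 2) + 2 * h β₂ ≤
      ENNReal.ofReal (l2norm (X.mulVec b - y₂) ^ 2) + 2 * h b) :
    l2norm (X.mulVec β₁ - X.mulVec β₂) ≤ l2norm (y₁ - y₂) := by
  obtain ⟨b₀, hb₀⟩ := hproper
  have hfin : ∀ {y : Fin n → ℝ} {β : Fin p → ℝ},
      ENNReal.ofReal (l2norm (X.mulVec β - y) ^ 2) + 2 * h β ≤
        ENNReal.ofReal (l2norm (X.mulVec b₀ - y) ^ 2) + 2 * h b₀ → h β ≠ ⊤ := by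
    intro y β hle htop
    rw [htop, ENNReal.mul_top two_ne_zero, add_top, top_le_iff] at hle
    exact absurd hle (by finiteness)
  have h₁ := inner_residual_le hconv hβ₁ (hfin (hβ₁ b₀)) (hfin (hβ₂ b₀))
  have h₂ := inner_residual_le hconv hβ₂ (hfin (hβ₂ b₀)) (hfin (hβ₁ b₀))
  rw [← neg_sub (ENNReal.toReal _)] at h₂
  rw [l2norm_eq_norm, l2norm_eq_norm]
  exact norm_sub_le_of_inner_le h₁ h₂

lemma abs_l2norm_sub_l2norm_le {k : ℕ} (u v : Fin k → ℝ) :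
    |l2norm u - l2norm v| ≤ l2norm (u - v) := by
  simp only [l2norm_eq_norm]
  exact abs_norm_sub_norm_le _ _

end Proximal

end GaussianConcentration

/-- for a convex, proper penalty admitting minimizers, the map
`ε ↦ ‖X(β̂-β*)‖` is 1-Lipschitz; consequently for Gaussian noise `N(0,σ²Iₙ)` the
prediction error satisfies Gaussian concentration around its median `m`. Here
`B e` denotes the solution `β̂` of the least-squares problem with data `y = Xβ* + e`. -/
theorem prediction_error_lipschitz_and_concentration {n p : ℕ}
    (X : Matrix (Fin n) (Fin p) ℝ) (bs : Fin p → ℝ)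
    (h : (Fin p → ℝ) → ℝ≥0∞)
    (hconv : ∀ b₁ b₂ : Fin p → ℝ, ∀ a : ℝ, 0 ≤ a → a ≤ 1 →
      h (a • b₁ + (1 - a) • b₂) ≤ ENNReal.ofReal a * h b₁ + ENNReal.ofReal (1 - a) * h b₂)
    (hproper : ∃ b : Fin p → ℝ, h b ≠ ⊤)
    (B : (Fin n → ℝ) → Fin p → ℝ)
    (hB : ∀ e : Fin n → ℝ, ∀ b : Fin p → ℝ,
      ENNReal.ofReal (l2norm (X.mulVec (B e) - (X.mulVec bs + e)) ^ 2) + 2 * h (B e) ≤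
        ENNReal.ofReal (l2norm (X.mulVec b - (X.mulVec bs + e)) ^ 2) + 2 * h b)
    {Ω : Type*} [MeasurableSpace Ω] (P : Measure Ω) [IsProbabilityMeasure P]
    (σ : ℝ≥0) (hσ : 0 < σ) (ε : Ω → Fin n → ℝ) (hmeas : Measurable ε)
    (hgauss : Measure.map ε P = Measure.pi fun _ : Fin n => gaussianReal 0 (σ ^ 2))
    (m : ℝ)
    (hm₁ : ENNReal.ofReal 0.5 ≤ P {ω : Ω | l2norm (X.mulVec (B (ε ω) - bs)) ≤ m})
    (hm₂ : ENNReal.ofReal 0.5 ≤ P {ω : Ω | m ≤ l2norm (X.mulVec (B (ε ω) - bs))}) :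
    (∀ e₁ e₂ : Fin n → ℝ,
      |l2norm (X.mulVec (B e₁ - bs)) - l2norm (X.mulVec (B e₂ - bs))| ≤
        l2norm (e₁ - e₂)) ∧
    (∀ x : ℝ, 0 < x →
      P {ω : Ω | m + σ * x ≤ l2norm (X.mulVec (B (ε ω) - bs))} ≤
          gaussianReal 0 1 (Set.Ici x) ∧
      P {ω : Ω | l2norm (X.mulVec (B (ε ω) - bs)) ≤ m - σ * x} ≤
          gaussianReal 0 1 (Set.Iic (-x))) := by
  have hlip : ∀ e₁ e₂ : Fin n → ℝ,
      |l2norm (X.mulVec (B e₁ - bs)) - l2norm (X.mulVec (B e₂ - bs))| ≤ l2norm (e₁ - e₂) := by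
    intro e₁ e₂
    refine (abs_l2norm_sub_l2norm_le _ _).trans ?_
    rw [Matrix.mulVec_sub, Matrix.mulVec_sub, sub_sub_sub_cancel_right,
      ← add_sub_add_left_eq_sub e₁ e₂ (X.mulVec bs)]
    exact norm_fit_sub_fit_le hconv hproper (hB e₁) (hB e₂)
  refine ⟨hlip, fun x hx => gaussian_concentration_of_lipschitz
    (f := fun e => l2norm (X.mulVec (B e - bs))) ?_ hσ hmeas hgauss hx ?_ ?_⟩
  · refine LipschitzWith.of_dist_le_mul fun z₁ z₂ => ?_
    rw [NNReal.coe_one, one_mul, Real.dist_eq, dist_eq_norm]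
    exact (hlip _ _).trans_eq (l2norm_eq_norm _)
  · convert hm₁ using 2
    norm_num
  · convert hm₂ using 2
    norm_num
end
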